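/- Let X and Y be CAT(0) cube complexes with no extremal vertices and let f : ∂X → ∂Y be a Möbius bijection. Given straight boundary points x1, x2, x, y1, y2, y ∈ ∂ₛX with x1 op_x x2 and y1 op_y y2, one has d(m(x1,x2,x), m(y1,y2,y)) = d(m(f(x1),f(x2),f(x)), m(f(y1),f(y2),f(y))). -/

import Mathlib

/-!
We use the standard combinatorial model of a CAT(0) cube complex: it is identified
with its vertex set endowed with the combinatorial (ℓ¹) metric, i.e. with a median
graph `G` on a vertex type `V`.  Halfspaces are realised as the vertex sets of the
two sides of the hyperplane dual to an edge, the Roller compactification `X̄` is the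
set of ultrafilters of halfspaces, vertices embedding via principal ultrafilters,
and the Roller boundary `∂X` consists of the non-principal ultrafilters.
-/

open scoped ENNReal
open Set

namespace CCCR

variable {V V' : Type*}

/-- The interval between two vertices w.r.t. the combinatorial metric. -/
def vInterval (G : SimpleGraph V) (u v : V) : Set V :=
  {w : V | G.dist u w + G.dist w v = G.dist u v}

/-- Combinatorial model of a CAT(0) cube complex (identified with its vertex set,
endowed with the combinatorial metric): a connected median graph. -/
def IsCCC (G : SimpleGraph V) : Prop :=
  G.Connected ∧ ∀ x y z : V, ∃! m : V,
    m ∈ vInterval G x y ∧ m ∈ vInterval G y z ∧ m ∈ vInterval G z x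

/-- Halfspaces of the cube complex: the sides of the hyperplane dual to an edge. -/
def IsHalfspace (G : SimpleGraph V) (h : Set V) : Prop :=
  ∃ u v : V, G.Adj u v ∧ h = {w : V | G.dist w v < G.dist w u}

/-- The halfspace dual to the (oriented) edge `(u,v)` containing `v`. -/
def edgeHalf (G : SimpleGraph V) (u v : V) : Set V :=
  {w : V | G.dist w v < G.dist w u}

/-- The hyperplane (wall) dual to the edge `(u,v)`, recorded as its pair of sides. -/
def wallOf (G : SimpleGraph V) (u v : V) : Set (Set V) :=
  {edgeHalf G u v, (edgeHalf G u v)ᶜ}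

/-- Two (necessarily distinct) hyperplanes, with respective sides `h` and `k`,
are transverse: all four quarter-spaces are nonempty. -/
def Transv (h k : Set V) : Prop :=
  (h ∩ k).Nonempty ∧ (h ∩ kᶜ).Nonempty ∧ (hᶜ ∩ k).Nonempty ∧ (hᶜ ∩ kᶜ).Nonempty

/-- An ultrafilter of halfspaces: a point of the Roller compactification X̄.
It contains exactly one side of each hyperplane, and any two members intersect. -/
def IsUltra (G : SimpleGraph V) (σ : Set (Set V)) : Prop :=
  (∀ h ∈ σ, IsHalfspace G h) ∧
  (∀ h : Set V, IsHalfspace G h → (h ∈ σ ↔ hᶜ ∉ σ)) ∧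
  (∀ h ∈ σ, ∀ k ∈ σ, (h ∩ k).Nonempty)

/-- The principal ultrafilter of a vertex, i.e. the image of `v` in X̄. -/
def princ (G : SimpleGraph V) (v : V) : Set (Set V) :=
  {h : Set V | IsHalfspace G h ∧ v ∈ h}

/-- A point of the Roller boundary ∂X = X̄ ∖ X: a non-principal ultrafilter. -/
def IsBdryPt (G : SimpleGraph V) (σ : Set (Set V)) : Prop :=
  IsUltra G σ ∧ ∀ v : V, σ ≠ princ G v

/-- The Roller boundary ∂X as a type. -/
abbrev Bdry (G : SimpleGraph V) : Type _ := {σ : Set (Set V) // IsBdryPt G σ}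

/-- The Gromov product (x·y)_v = #𝒲(v | x, y) ∈ ℕ ∪ {+∞}, counted through the
sides containing both x and y but not v. -/
noncomputable def grom (_G : SimpleGraph V) (v : V) (x y : Set (Set V)) : ℕ∞ :=
  {h : Set V | h ∈ x ∧ h ∈ y ∧ v ∉ h}.encard

/-- The embedding ℕ ∪ {+∞} → ℤ ∪ {±∞}. -/
noncomputable def toE (n : ℕ∞) : EReal := ((n : ℝ≥0∞) : EReal)

/-- The cross ratio cr_v(x,y,z,w) = (x·z)_v + (y·w)_v − (x·w)_v − (y·z)_v ∈ ℤ ∪ {±∞}. -/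
noncomputable def crv (G : SimpleGraph V) (v : V) (x y z w : Set (Set V)) : EReal :=
  toE (grom G v x z) + toE (grom G v y w) - toE (grom G v x w) - toE (grom G v y z)

/-- The triple of sums of Gromov products attached to a 4-tuple. -/
noncomputable def tripod (G : SimpleGraph V) (v : V) (x y z w : Set (Set V)) :
    ℕ∞ × ℕ∞ × ℕ∞ :=
  (grom G v x y + grom G v z w, grom G v x z + grom G v y w, grom G v x w + grom G v y z)

/-- (x,y,z,w) ∈ 𝒜 w.r.t. the basepoint v: at most one of the three sums is infinite. -/
def inA (G : SimpleGraph V) (v : V) (x y z w : Set (Set V)) : Prop :=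
  ((tripod G v x y z w).1 ≠ ⊤ ∧ (tripod G v x y z w).2.1 ≠ ⊤) ∨
  ((tripod G v x y z w).1 ≠ ⊤ ∧ (tripod G v x y z w).2.2 ≠ ⊤) ∨
  ((tripod G v x y z w).2.1 ≠ ⊤ ∧ (tripod G v x y z w).2.2 ≠ ⊤)

/-- (x,y,z,w) ∈ 𝒜 (this is independent of the basepoint). -/
def memA (G : SimpleGraph V) (x y z w : Set (Set V)) : Prop :=
  ∀ v : V, inA G v x y z w

/-- Two triples in (ℕ ∪ {+∞})³ are equivalent if they differ by adding a constant
n ∈ ℕ to all three entries. -/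
def TripEquiv (p q : ℕ∞ × ℕ∞ × ℕ∞) : Prop :=
  (∃ n : ℕ, p.1 = q.1 + (n : ℕ∞) ∧ p.2.1 = q.2.1 + (n : ℕ∞) ∧ p.2.2 = q.2.2 + (n : ℕ∞)) ∨
  (∃ n : ℕ, q.1 = p.1 + (n : ℕ∞) ∧ q.2.1 = p.2.1 + (n : ℕ∞) ∧ q.2.2 = p.2.2 + (n : ℕ∞))

/-- crt(x,y,z,w) = ⟪a:b:c⟫ (the cross ratio triple is independent of the basepoint,
so we require the equality of classes at every basepoint). -/
def crtEq (G : SimpleGraph V) (x y z w : Set (Set V)) (a b c : ℕ∞) : Prop :=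
  ∀ v : V, TripEquiv (tripod G v x y z w) (a, b, c)

/-- The median of three points of X̄. -/
def med (x y z : Set (Set V)) : Set (Set V) := (x ∩ y) ∪ (y ∩ z) ∪ (z ∩ x)

/-- The interval I(x,y) ⊆ X̄ between two points of X̄. -/
def rInterval (G : SimpleGraph V) (x y : Set (Set V)) : Set (Set (Set V)) :=
  {σ : Set (Set V) | IsUltra G σ ∧ x ∩ y ⊆ σ}

/-- `Op G x y z` : x and y are opposite with respect to z, i.e. the median
m = m(x,y,z) lies in X and I(x,y) = I(x,m) ∪ I(m,y). -/
def Op (G : SimpleGraph V) (x y z : Set (Set V)) : Prop :=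
  (∃ p : V, med x y z = princ G p) ∧
  rInterval G x y = rInterval G x (med x y z) ∪ rInterval G (med x y z) y

/-- A geodesic ray (based at `r 0`). -/
def IsGeodRay (G : SimpleGraph V) (r : ℕ → V) : Prop :=
  (∀ n : ℕ, G.Adj (r n) (r (n + 1))) ∧
  ∀ m n : ℕ, m ≤ n → G.dist (r m) (r n) = n - m

/-- A bi-infinite geodesic line. -/
def IsGeodLine (G : SimpleGraph V) (L : ℤ → V) : Prop :=
  (∀ n : ℤ, G.Adj (L n) (L (n + 1))) ∧
  ∀ m n : ℤ, m ≤ n → (G.dist (L m) (L n) : ℤ) = n - m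

/-- The set 𝒲(r) of hyperplanes crossed by (the edges of) a ray. -/
def rayWalls (G : SimpleGraph V) (r : ℕ → V) : Set (Set (Set V)) :=
  {W : Set (Set V) | ∃ n : ℕ, W = wallOf G (r n) (r (n + 1))}

/-- A hyperplane is adjacent to `v` if it is dual to an edge incident to `v`. -/
def WallAdjTo (G : SimpleGraph V) (v : V) (W : Set (Set V)) : Prop :=
  ∃ u : V, G.Adj v u ∧ W = wallOf G v u

/-- A straight ray: no two of the hyperplanes it crosses are transverse. -/
def RayStraight (G : SimpleGraph V) (r : ℕ → V) : Prop :=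
  ∀ m n : ℕ, ¬ Transv (edgeHalf G (r m) (r (m + 1))) (edgeHalf G (r n) (r (n + 1)))

/-- A straight line: no two of the hyperplanes it crosses are transverse. -/
def LineStraight (G : SimpleGraph V) (L : ℤ → V) : Prop :=
  ∀ m n : ℤ, ¬ Transv (edgeHalf G (L m) (L (m + 1))) (edgeHalf G (L n) (L (n + 1)))

/-- The endpoint at infinity r⁺ ∈ ∂X of a ray: the ultrafilter of those halfspaces
containing all but finitely many of its vertices. -/
def rayEnd (G : SimpleGraph V) (r : ℕ → V) : Set (Set V) :=
  {h : Set V | IsHalfspace G h ∧ ∃ N : ℕ, ∀ n : ℕ, N ≤ n → r n ∈ h}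

/-- A straight point of the Roller boundary: the endpoint at infinity of a straight ray. -/
def IsStraightPt (G : SimpleGraph V) (x : Set (Set V)) : Prop :=
  ∃ r : ℕ → V, IsGeodRay G r ∧ RayStraight G r ∧ rayEnd G r = x

/-- x and y are the two endpoints at infinity of the line L. -/
def LineEnds (G : SimpleGraph V) (L : ℤ → V) (x y : Set (Set V)) : Prop :=
  rayEnd G (fun n : ℕ => L (n : ℤ)) = x ∧ rayEnd G (fun n : ℕ => L (-(n : ℤ))) = y

/-- The edges from `v` to `a` and from `v` to `b` span a square. -/
def SpansSquare (G : SimpleGraph V) (v a b : V) : Prop :=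
  ∃ w : V, w ≠ v ∧ G.Adj a w ∧ G.Adj b w

/-- An extremal vertex: some edge at `v` spans a square with every other edge at `v`. -/
def Extremal (G : SimpleGraph V) (v : V) : Prop :=
  ∃ a : V, G.Adj v a ∧ ∀ b : V, G.Adj v b → b ≠ a → SpansSquare G v a b

/-- The cube complex has no extremal vertices. -/
def NoExtremal (G : SimpleGraph V) : Prop := ∀ v : V, ¬ Extremal G v

/-- A skinny vertex: exactly two incident edges. -/
def Skinny (G : SimpleGraph V) (v : V) : Prop := {u : V | G.Adj v u}.encard = 2

/-- A skinny ray: a geodesic ray whose initial vertex has at least three incident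
edges and all of whose other vertices are skinny. -/
def IsSkinnyRay (G : SimpleGraph V) (r : ℕ → V) : Prop :=
  IsGeodRay G r ∧ 3 ≤ {u : V | G.Adj (r 0) u}.encard ∧ ∀ n : ℕ, 1 ≤ n → Skinny G (r n)

/-- (The vertex set of) a cube of the complex: a subset inducing a hypercube graph. -/
def IsCube (G : SimpleGraph V) (c : Set V) : Prop :=
  ∃ (n : ℕ) (e : c ≃ (Fin n → Bool)),
    ∀ a b : c, G.Adj (a : V) (b : V) ↔ ∃! i : Fin n, e a i ≠ e b i

/-- A maximal cube. -/
def IsMaxCube (G : SimpleGraph V) (c : Set V) : Prop :=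
  IsCube G c ∧ ∀ c' : Set V, IsCube G c' → c ⊆ c' → c' = c

/-- Completeness: there is no infinite ascending chain of cubes. -/
def CubeComplete (G : SimpleGraph V) : Prop :=
  ¬ ∃ c : ℕ → Set V, (∀ n : ℕ, IsCube G (c n)) ∧ ∀ n : ℕ, c n ⊂ c (n + 1)

/-- No free faces: no non-maximal cube is contained in a unique maximal cube. -/
def NoFreeFaces (G : SimpleGraph V) : Prop :=
  ∀ c : Set V, IsCube G c → ¬ IsMaxCube G c → ¬ ∃! m : Set V, IsMaxCube G m ∧ c ⊆ m

/-- #𝒲(x, z | y, w): the number of hyperplanes separating x and z from y and w,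
counted through the sides containing x and z. -/
noncomputable def sepCount (x z y w : Set (Set V)) : ℕ∞ :=
  {h : Set V | h ∈ x ∧ h ∈ z ∧ h ∉ y ∧ h ∉ w}.encard

/-- A Möbius map between Roller boundaries: it maps 𝒜(X) into 𝒜(Y) and preserves
cross ratios. -/
def Mobius (G : SimpleGraph V) (G' : SimpleGraph V') (f : Bdry G → Bdry G') : Prop :=
  ∀ x y z w : Bdry G, memA G x.1 y.1 z.1 w.1 →
    memA G' (f x).1 (f y).1 (f z).1 (f w).1 ∧
    ∀ (v : V) (v' : V'),
      crv G' v' (f x).1 (f y).1 (f z).1 (f w).1 = crv G v x.1 y.1 z.1 w.1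

/-- The induced action of a cubical isomorphism on X̄: an ultrafilter is mapped to
the set of images of its halfspaces. -/
def mapUltra (φ : V → V') (σ : Set (Set V)) : Set (Set V') :=
  (fun h : Set V => φ '' h) '' σ

/-- The standard cubulation of ℝ: vertex set ℤ, edges between consecutive integers. -/
def zline : SimpleGraph ℤ := SimpleGraph.fromRel (fun m n => n = m + 1)

end CCCR

namespace CCCR

section basic
variable {V : Type*} {G : SimpleGraph V}

lemma dsymm (a b : V) : G.dist a b = G.dist b a := SimpleGraph.dist_comm

lemma half_dichotomy (hG : IsCCC G) {u v : V} (h : G.Adj u v) (w : V) :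
    G.dist w u = G.dist w v + 1 ∨ G.dist w v = G.dist w u + 1 := by
  obtain ⟨m, ⟨h1, h2, h3⟩, -⟩ := hG.2 u v w
  simp only [vInterval, mem_ofPred_eq] at h1 h2 h3
  have huv : G.dist u v = 1 := SimpleGraph.dist_eq_one_iff_adj.2 h
  have e1 := dsymm (G := G) u m
  have e2 := dsymm (G := G) v m
  have e3 := dsymm (G := G) w m
  have e4 := dsymm (G := G) w v
  have e5 := dsymm (G := G) u v
  rcases Nat.eq_zero_or_pos (G.dist u m) with h0 | h0
  · have : u = m := (hG.1.dist_eq_zero_iff).1 h0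
    subst this
    omega
  · have h0' : G.dist m v = 0 := by omega
    have : m = v := (hG.1.dist_eq_zero_iff).1 h0'
    subst this
    omega

lemma edgeHalf_compl (hG : IsCCC G) {u v : V} (h : G.Adj u v) :
    (edgeHalf G u v)ᶜ = edgeHalf G v u := by
  ext w
  simp only [edgeHalf, mem_compl_iff, mem_ofPred_eq]
  rcases half_dichotomy hG h w with h | h <;> omega

lemma half_of_edge {u v : V} (h : G.Adj u v) : IsHalfspace G (edgeHalf G u v) := ⟨u, v, h, rfl⟩

lemma half_compl (hG : IsCCC G) {h : Set V} (hh : IsHalfspace G h) : IsHalfspace G hᶜ := by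
  obtain ⟨u, v, a, rfl⟩ := hh
  exact ⟨v, u, a.symm, edgeHalf_compl hG a⟩

lemma mem_edgeHalf {u v : V} (h : G.Adj u v) : v ∈ edgeHalf G u v := by
  have := SimpleGraph.dist_eq_one_iff_adj.2 h.symm
  simp [edgeHalf, this]

lemma notMem_edgeHalf {u v : V} : u ∉ edgeHalf G u v := by
  simp [edgeHalf]

/-- points of `I(x,v)` are in the halfspace of `v` when `x` is -/
lemma half_star (hG : IsCCC G) {u v x p : V} (h : G.Adj u v)
    (hx : G.dist x u = G.dist x v + 1) (hp : G.dist x p + G.dist p v = G.dist x v) :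
    G.dist p u = G.dist p v + 1 := by
  have t := hG.1.dist_triangle (u := x) (v := p) (w := u)
  rcases half_dichotomy hG h p with h | h <;> omega

/-- medians with the distances in a normal form -/
lemma med_norm (hG : IsCCC G) (x y z : V) : ∃ m, G.dist x m + G.dist y m = G.dist x y ∧
    G.dist y m + G.dist z m = G.dist y z ∧ G.dist x m + G.dist z m = G.dist x z := by
  obtain ⟨m, ⟨h1, h2, h3⟩, -⟩ := hG.2 x y z
  simp only [vInterval, mem_ofPred_eq] at h1 h2 h3
  have e1 := dsymm (G := G) m y
  have e2 := dsymm (G := G) m z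
  have e3 := dsymm (G := G) m x
  have e4 := dsymm (G := G) z x
  exact ⟨m, by omega, by omega, by omega⟩

lemma med_unique (hG : IsCCC G) {x y z m m' : V}
    (h1 : G.dist x m + G.dist y m = G.dist x y)
    (h2 : G.dist y m + G.dist z m = G.dist y z) (h3 : G.dist x m + G.dist z m = G.dist x z)
    (h1' : G.dist x m' + G.dist y m' = G.dist x y)
    (h2' : G.dist y m' + G.dist z m' = G.dist y z) (h3' : G.dist x m' + G.dist z m' = G.dist x z) :
    m = m' := by
  apply (hG.2 x y z).unique
  · simp only [vInterval, mem_ofPred_eq]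
    rw [dsymm m y, dsymm m z, dsymm m x, dsymm z x]
    omega
  · simp only [vInterval, mem_ofPred_eq]
    rw [dsymm m' y, dsymm m' z, dsymm m' x, dsymm z x]
    omega

lemma half_convex_aux2 (hG : IsCCC G) {u v : V} (h : G.Adj u v) {s t w : V}
    (hs : G.dist u s = G.dist v s + 1) (ht : G.dist u t = G.dist v t + 1)
    (hw : G.dist v w = G.dist u w + 1)
    (h1 : G.dist w s + G.dist v s = G.dist v w) (h2 : G.dist w t + G.dist v t = G.dist v w)
    (hst : G.dist s t = G.dist w s + G.dist w t) : False := by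
  have star : ∀ {u v x p : V}, G.Adj u v → G.dist u x = G.dist v x + 1 →
      G.dist x p + G.dist v p = G.dist v x → G.dist u p = G.dist v p + 1 := by
    intro u v x p h hx hp
    rw [dsymm u p, dsymm v p]
    rw [dsymm u x, dsymm v x] at hx
    rw [dsymm v p, dsymm v x] at hp
    exact half_star hG h hx hp
  obtain ⟨e, e1, e2, e3⟩ := med_norm hG s w u
  obtain ⟨e', e1', e2', e3'⟩ := med_norm hG t w u
  rw [dsymm s w] at e1
  rw [dsymm t w] at e1'
  rw [dsymm w u] at e2 e2'
  rw [dsymm s u] at e3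
  rw [dsymm t u] at e3'
  have ee : G.dist s e = 1 := by omega
  have ee' : G.dist t e' = 1 := by omega
  have he := star h.symm hw (p := e) (by omega)
  have de : G.dist s t ≤ 1 + G.dist e e' + 1 := by
    have tr1 := hG.1.dist_triangle (u := s) (v := e) (w := t)
    have tr2 := hG.1.dist_triangle (u := e) (v := e') (w := t)
    rw [dsymm e' t] at tr2
    omega
  have de2 : G.dist e e' ≤ G.dist w e + G.dist w e' := by
    have tr1 := hG.1.dist_triangle (u := e) (v := w) (w := e')
    rw [dsymm e w] at tr1
    omega
  have dee : G.dist e e' + 2 = G.dist w s + G.dist w t := by omega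
  clear de de2
  obtain ⟨r, r1, r2, r3⟩ := med_norm hG s t v
  obtain ⟨q, q1, q2, q3⟩ := med_norm hG e e' u
  rw [dsymm t v] at r2
  rw [dsymm s v] at r3
  rw [dsymm e' u] at q2
  rw [dsymm e u] at q3
  have hr := star h hs (p := r) (by omega)
  have hq := star h.symm he (p := q) (by omega)
  have trq1 := hG.1.dist_triangle (u := s) (v := e) (w := q)
  have trq2 := hG.1.dist_triangle (u := t) (v := e') (w := q)
  have trq3 := hG.1.dist_triangle (u := s) (v := q) (w := t)
  have trq4 := hG.1.dist_triangle (u := s) (v := q) (w := u)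
  have trq5 := hG.1.dist_triangle (u := t) (v := q) (w := u)
  rw [dsymm q t] at trq3
  rw [dsymm q u, dsymm s u] at trq4
  rw [dsymm q u, dsymm t u] at trq5
  have k1 : G.dist s q + G.dist t q = G.dist s t := by linarith
  have k2 : G.dist t q + G.dist u q = G.dist u t := by linarith
  have k3 : G.dist s q + G.dist u q = G.dist u s := by linarith
  have := med_unique hG (x := s) (y := t) (z := u) (m := q) (m' := r) k1
    (by rw [dsymm t u]; exact k2) (by rw [dsymm s u]; exact k3) r1
    (by rw [dsymm t u]; linarith) (by rw [dsymm s u]; linarith)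
  subst this
  linarith

lemma half_convex_aux (hG : IsCCC G) {u v : V} (h : G.Adj u v) {x y w : V}
    (hx : G.dist x u = G.dist x v + 1) (hy : G.dist y u = G.dist y v + 1)
    (hw : G.dist x w + G.dist w y = G.dist x y) : G.dist w u = G.dist w v + 1 := by
  rcases half_dichotomy hG h w with h1 | h1
  · exact h1
  exfalso
  obtain ⟨s, s1, s2, s3⟩ := med_norm hG w x v
  obtain ⟨t, t1, t2, t3⟩ := med_norm hG w y v
  have hs := half_star hG h hx (p := s) (by rw [dsymm s v]; exact s2)
  have ht := half_star hG h hy (p := t) (by rw [dsymm t v]; exact t2)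
  have tr1 := hG.1.dist_triangle (u := x) (v := s) (w := y)
  have tr2 := hG.1.dist_triangle (u := s) (v := t) (w := y)
  have tr3 := hG.1.dist_triangle (u := s) (v := w) (w := t)
  rw [dsymm t y] at tr2
  rw [dsymm s w] at tr3
  rw [dsymm x w] at hw
  refine half_convex_aux2 hG h (s := s) (t := t) (w := w) ?_ ?_ ?_ ?_ ?_ ?_
  · rw [dsymm u s, dsymm v s]; exact hs
  · rw [dsymm u t, dsymm v t]; exact ht
  · rw [dsymm u w, dsymm v w]; exact h1
  · rw [dsymm v w]; exact s3
  · rw [dsymm v w]; exact t3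
  · omega

def Conv (G : SimpleGraph V) (h : Set V) : Prop :=
  ∀ x ∈ h, ∀ y ∈ h, ∀ w, G.dist x w + G.dist w y = G.dist x y → w ∈ h

lemma half_convex (hG : IsCCC G) {h : Set V} (hh : IsHalfspace G h) : Conv G h := by
  obtain ⟨u, v, a, rfl⟩ := hh
  intro x hx y hy w hw
  simp only [mem_ofPred_eq] at *
  have := half_convex_aux hG a (x := x) (y := y) (w := w)
    (by rcases half_dichotomy hG a x with h | h <;> omega)
    (by rcases half_dichotomy hG a y with h | h <;> omega) hw
  omega

/-- an edge crossing a halfspace determines it -/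
lemma half_eq (hG : IsCCC G) {h : Set V} (hh : IsHalfspace G h) {a b : V} (hab : G.Adj a b)
    (ha : a ∉ h) (hb : b ∈ h) : h = edgeHalf G a b := by
  have c1 := half_convex hG hh
  have c2 := half_convex hG (half_compl hG hh)
  have e : G.dist a b = 1 := SimpleGraph.dist_eq_one_iff_adj.2 hab
  have e' := dsymm (G := G) a b
  ext x
  constructor
  · intro hx
    by_contra hn
    simp only [edgeHalf, mem_ofPred_eq] at hn
    refine ha (c1 x hx b hb a ?_)
    rcases half_dichotomy hG hab x with h | h <;> omega
  · intro hx
    by_contra hn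
    simp only [edgeHalf, mem_ofPred_eq] at hx
    refine c2 x hn a ha b ?_ hb
    rcases half_dichotomy hG hab x with h | h <;> omega

lemma exists_step (hG : IsCCC G) {a b : V} {n : ℕ} (h : G.dist a b = n + 1) :
    ∃ u, G.Adj a u ∧ G.dist u b = n := by
  obtain ⟨p, hp⟩ := hG.1.exists_walk_length_eq_dist a b
  cases p with
  | nil => simp at h
  | @cons _ u _ hadj q =>
    refine ⟨u, hadj, ?_⟩
    simp at hp
    have t := hG.1.dist_triangle (u := a) (v := u) (w := b)
    have e : G.dist a u = 1 := SimpleGraph.dist_eq_one_iff_adj.2 hadj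
    have := SimpleGraph.dist_le q
    omega

/-- number of separating halfspaces -/
lemma sep_count (hG : IsCCC G) : ∀ (k : ℕ) (a b : V), G.dist a b = k →
    {h : Set V | IsHalfspace G h ∧ b ∈ h ∧ a ∉ h}.encard = (k : ℕ∞) := by
  intro k
  induction k with
  | zero =>
    intro a b h
    have : a = b := (hG.1.dist_eq_zero_iff).1 h
    subst this
    have : {h : Set V | IsHalfspace G h ∧ a ∈ h ∧ a ∉ h} = ∅ := by
      ext h; simp
    rw [this]; simp
  | succ k ih =>
    intro a b h
    obtain ⟨u, hadj, hu⟩ := exists_step hG h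
    have e : G.dist a u = 1 := SimpleGraph.dist_eq_one_iff_adj.2 hadj
    have key : {h : Set V | IsHalfspace G h ∧ b ∈ h ∧ a ∉ h} =
        insert (edgeHalf G a u) {h : Set V | IsHalfspace G h ∧ b ∈ h ∧ u ∉ h} := by
      ext t
      simp only [mem_ofPred_eq, mem_insert_iff]
      constructor
      · rintro ⟨h1, h2, h3⟩
        by_cases hut : u ∈ t
        · exact Or.inl (half_eq hG h1 hadj h3 hut)
        · exact Or.inr ⟨h1, h2, hut⟩
      · rintro (rfl | ⟨h1, h2, h3⟩)
        · refine ⟨half_of_edge hadj, ?_, notMem_edgeHalf⟩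
          simp only [edgeHalf, mem_ofPred_eq]
          rw [dsymm b u, dsymm b a]; omega
        · exact ⟨h1, h2, fun ha => h3 (half_convex hG h1 a ha b h2 u (by omega))⟩
    rw [key, encard_insert_of_notMem, ih u b hu]
    · push_cast; rfl
    · simp only [mem_ofPred_eq, not_and]
      intro _ _ h; exact h (mem_edgeHalf hadj)

lemma sep_finite (hG : IsCCC G) (a b : V) :
    {h : Set V | IsHalfspace G h ∧ b ∈ h ∧ a ∉ h}.Finite := by
  rw [← encard_ne_top_iff, sep_count hG _ a b rfl]
  simp

lemma half_nonempty {h : Set V} (hh : IsHalfspace G h) : h.Nonempty := by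
  obtain ⟨u, v, a, rfl⟩ := hh
  exact ⟨v, mem_edgeHalf a⟩

/-- every halfspace missing `v` is contained in one adjacent to `v` -/
lemma adj_half (hG : IsCCC G) {h : Set V} (hh : IsHalfspace G h) {v : V} (hv : v ∉ h) :
    ∃ u, G.Adj v u ∧ h ⊆ edgeHalf G v u := by
  classical
  have hex : ∃ n, ∃ p ∈ h, G.dist v p = n := by
    obtain ⟨p, hp⟩ := half_nonempty hh
    exact ⟨_, p, hp, rfl⟩
  obtain ⟨p, hp, hpn⟩ := Nat.find_spec hex
  have hmin : ∀ q ∈ h, G.dist v p ≤ G.dist v q := by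
    intro q hq
    rw [hpn]
    exact Nat.find_min' hex ⟨q, hq, rfl⟩
  have hgate : ∀ q ∈ h, G.dist v p + G.dist p q = G.dist v q := by
    intro q hq
    obtain ⟨m, ⟨h1, h2, h3⟩, -⟩ := hG.2 v p q
    simp only [vInterval, mem_ofPred_eq] at h1 h2 h3
    have hm := hmin m (half_convex hG hh p hp q hq m h2)
    have : G.dist m p = 0 := by omega
    have : m = p := (hG.1.dist_eq_zero_iff).1 this
    subst this
    rw [dsymm v m, dsymm m q, dsymm v q, add_comm]; exact h3
  have hne : G.dist v p ≠ 0 := by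
    intro h0
    have := (hG.1.dist_eq_zero_iff).1 h0
    subst this
    exact hv hp
  obtain ⟨n, hn⟩ := Nat.exists_eq_succ_of_ne_zero hne
  obtain ⟨u, hadj, hu⟩ := exists_step hG hn
  refine ⟨u, hadj, ?_⟩
  intro q hq
  have := hgate q hq
  have t := hG.1.dist_triangle (u := u) (v := p) (w := q)
  simp only [edgeHalf, mem_ofPred_eq]
  rw [dsymm q u, dsymm q v]
  omega

lemma square_of_inter (hG : IsCCC G) {v a b q : V} (ha : G.Adj v a) (hb : G.Adj v b)
    (hab : b ≠ a) (q1 : q ∈ edgeHalf G v a) (q2 : q ∈ edgeHalf G v b) : SpansSquare G v a b := by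
  simp only [edgeHalf, mem_ofPred_eq] at q1 q2
  have ea : G.dist v a = 1 := SimpleGraph.dist_eq_one_iff_adj.2 ha
  have eb : G.dist v b = 1 := SimpleGraph.dist_eq_one_iff_adj.2 hb
  have da := half_dichotomy hG ha q
  have db := half_dichotomy hG hb q
  have hab0 : G.dist a b ≠ 0 := fun h => hab ((hG.1.dist_eq_zero_iff).1 h).symm
  have t := hG.1.dist_triangle (u := a) (v := v) (w := b)
  have c1 := dsymm (G := G) a v
  have hab1 : G.dist a b ≠ 1 := by
    intro h
    have := half_dichotomy hG (SimpleGraph.dist_eq_one_iff_adj.1 h) q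
    omega
  obtain ⟨s, ⟨h1, h2, h3⟩, -⟩ := hG.2 a b q
  simp only [vInterval, mem_ofPred_eq] at h1 h2 h3
  have c2 := dsymm (G := G) b s
  have c3 := dsymm (G := G) a s
  have c4 := dsymm (G := G) q s
  have c5 := dsymm (G := G) q b
  have c6 := dsymm (G := G) q a
  refine ⟨s, ?_, ?_, ?_⟩
  · rintro rfl
    omega
  · apply SimpleGraph.dist_eq_one_iff_adj.1; omega
  · apply SimpleGraph.dist_eq_one_iff_adj.1; omega

lemma exists_disj (hG : IsCCC G) (hne : NoExtremal G) {v a : V} (ha : G.Adj v a) :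
    ∃ b, G.Adj v b ∧ edgeHalf G v b ∩ edgeHalf G v a = ∅ := by
  have := hne v
  simp only [Extremal, not_exists, not_and, not_forall] at this
  obtain ⟨b, hb, hba, hs⟩ := this a ha
  refine ⟨b, hb, ?_⟩
  by_contra hn
  obtain ⟨q, q1, q2⟩ := nonempty_iff_ne_empty.2 hn
  exact hs (square_of_inter hG ha hb hba q2 q1)

/-- Lemma L -/
lemma exists_disj' (hG : IsCCC G) (hne : NoExtremal G) {v : V} {h : Set V}
    (hh : IsHalfspace G h) (hv : v ∉ h) :
    ∃ b, G.Adj v b ∧ edgeHalf G v b ∩ h = ∅ := by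
  obtain ⟨u, hu, hsub⟩ := adj_half hG hh hv
  obtain ⟨b, hb, hd⟩ := exists_disj hG hne hu
  exact ⟨b, hb, subset_eq_empty (inter_subset_inter_right _ hsub) hd⟩

/-! ultrafilters -/

lemma ultra_compl (_hG : IsCCC G) {σ : Set (Set V)} (hs : IsUltra G σ) {h : Set V}
    (hh : IsHalfspace G h) (hn : h ∉ σ) : hᶜ ∈ σ := by
  by_contra hc
  exact hn ((hs.2.1 h hh).2 hc)

lemma ultra_up (hG : IsCCC G) {σ : Set (Set V)} (hs : IsUltra G σ) {h k : Set V}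
    (hh : h ∈ σ) (hk : IsHalfspace G k) (hsub : h ⊆ k) : k ∈ σ := by
  by_contra hn
  obtain ⟨q, q1, q2⟩ := hs.2.2 h hh _ (ultra_compl hG hs hk hn)
  exact q2 (hsub q1)

lemma ultra_disj {σ : Set (Set V)} (hs : IsUltra G σ) {h k : Set V}
    (hh : h ∈ σ) (hk : k ∈ σ) (hd : h ∩ k = ∅) : False := by
  have := hs.2.2 h hh k hk
  rw [hd] at this
  exact not_nonempty_empty this

lemma ultra_principal (hG : IsCCC G) {σ : Set (Set V)} (hs : IsUltra G σ) :
    ∀ (n : ℕ) (v : V), {h | h ∈ σ ∧ v ∉ h}.encard = (n : ℕ∞) → ∃ p, σ = princ G p := by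
  intro n
  induction n with
  | zero =>
    intro v hv
    simp only [Nat.cast_zero, encard_eq_zero] at hv
    have hv' : ∀ h ∈ σ, v ∈ h := by
      intro h hh
      by_contra hn
      have : h ∈ {h | h ∈ σ ∧ v ∉ h} := ⟨hh, hn⟩
      rw [hv] at this
      exact this
    refine ⟨v, ?_⟩
    ext h
    constructor
    · intro hh; exact ⟨hs.1 h hh, hv' h hh⟩
    · rintro ⟨h1, h2⟩
      by_contra hn
      exact hv' _ (ultra_compl hG hs h1 hn) h2
  | succ n ih =>
    intro v hv
    have hne : {h | h ∈ σ ∧ v ∉ h}.Nonempty := by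
      rw [nonempty_iff_ne_empty]
      intro h0
      rw [h0] at hv
      simp at hv
      exact absurd hv.symm (by simp)
    obtain ⟨h, hh, hvh⟩ := hne
    obtain ⟨u, hu, hsub⟩ := adj_half hG (hs.1 h hh) hvh
    have huσ := ultra_up hG hs hh (half_of_edge hu) hsub
    apply ih u
    have key : {h | h ∈ σ ∧ v ∉ h} = insert (edgeHalf G v u) {h | h ∈ σ ∧ u ∉ h} := by
      ext t
      simp only [mem_ofPred_eq, mem_insert_iff]
      constructor
      · rintro ⟨h1, h2⟩
        by_cases hut : u ∈ t
        · exact Or.inl (half_eq hG (hs.1 t h1) hu h2 hut)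
        · exact Or.inr ⟨h1, hut⟩
      · rintro (rfl | ⟨h1, h2⟩)
        · exact ⟨huσ, notMem_edgeHalf⟩
        · refine ⟨h1, fun hv => ?_⟩
          have e := half_eq hG (hs.1 t h1) hu.symm h2 hv
          rw [e, ← edgeHalf_compl hG hu] at h1
          exact ((hs.2.1 _ (half_of_edge hu)).1 huσ) h1
    rw [key, encard_insert_of_notMem] at hv
    · push_cast at hv
      exact (ENat.add_left_injective_of_ne_top (by simp)) hv
    · simp only [mem_ofPred_eq, not_and]
      intro _ h; exact h (mem_edgeHalf hu)

lemma grom_comm (v : V) (a b : Set (Set V)) : grom G v a b = grom G v b a := by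
  unfold grom; congr 1; ext; simp only [mem_ofPred_eq]; tauto

lemma grom_self_top (hG : IsCCC G) (v : V) {a : Set (Set V)} (ha : IsBdryPt G a) :
    grom G v a a = ⊤ := by
  by_contra hn
  obtain ⟨n, hn⟩ := ENat.ne_top_iff_exists.1 hn
  have : {h | h ∈ a ∧ v ∉ h}.encard = (n : ℕ∞) := by
    rw [hn]; unfold grom; congr 1; ext; simp only [mem_ofPred_eq]; tauto
  obtain ⟨p, hp⟩ := ultra_principal hG ha.1 n v this
  exact ha.2 p hp

lemma grom_base (hG : IsCCC G) {a b : Set (Set V)} (ha : IsUltra G a) (v w : V)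
    (h : grom G v a b ≠ ⊤) : grom G w a b ≠ ⊤ := by
  unfold grom at *
  rw [encard_ne_top_iff] at *
  refine (h.union (sep_finite hG w v)).subset ?_
  rintro t ⟨h1, h2, h3⟩
  by_cases hv : v ∈ t
  · exact Or.inr ⟨ha.1 t h1, hv, h3⟩
  · exact Or.inl ⟨h1, h2, hv⟩

lemma grom_zero {v : V} {a b : Set (Set V)} (h : ∀ t ∈ a, t ∈ b → v ∈ t) : grom G v a b = 0 := by
  unfold grom
  rw [encard_eq_zero]
  ext t
  simp only [mem_ofPred_eq, mem_empty_iff_false, iff_false]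
  rintro ⟨h1, h2, h3⟩
  exact h3 (h t h1 h2)

lemma grom_zero' {v : V} {a b : Set (Set V)} (h : grom G v a b = 0) :
    ∀ t ∈ a, t ∈ b → v ∈ t := by
  intro t h1 h2
  by_contra h3
  unfold grom at h
  rw [encard_eq_zero] at h
  have : t ∈ {h | h ∈ a ∧ h ∈ b ∧ v ∉ h} := ⟨h1, h2, h3⟩
  rw [h] at this
  exact this

lemma med_ultra (_hG : IsCCC G) {a b c : Set (Set V)} (ha : IsUltra G a) (hb : IsUltra G b)
    (hc : IsUltra G c) : IsUltra G (med a b c) := by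
  refine ⟨?_, ?_, ?_⟩
  · rintro h ((⟨h1, -⟩ | ⟨h1, -⟩) | ⟨h1, -⟩)
    exacts [ha.1 h h1, hb.1 h h1, hc.1 h h1]
  · intro h hh
    have h1 := ha.2.1 h hh
    have h2 := hb.2.1 h hh
    have h3 := hc.2.1 h hh
    simp only [med, mem_union, mem_inter_iff]
    tauto
  · intro h hh k hk
    simp only [med, mem_union, mem_inter_iff] at hh hk
    have : (h ∈ a ∧ k ∈ a) ∨ (h ∈ b ∧ k ∈ b) ∨ (h ∈ c ∧ k ∈ c) := by tauto
    rcases this with h | h | h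
    exacts [ha.2.2 _ h.1 _ h.2, hb.2.2 _ h.1 _ h.2, hc.2.2 _ h.1 _ h.2]

lemma med_princ (hG : IsCCC G) {a b c : Set (Set V)} (ha : IsUltra G a) (hb : IsUltra G b)
    (hc : IsUltra G c) (v : V) (h1 : grom G v a b ≠ ⊤) (h2 : grom G v b c ≠ ⊤)
    (h3 : grom G v c a ≠ ⊤) : ∃ p, med a b c = princ G p := by
  have hf : {h | h ∈ med a b c ∧ v ∉ h}.Finite := by
    unfold grom at *
    rw [encard_ne_top_iff] at *
    refine ((h1.union h2).union h3).subset ?_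
    rintro t ⟨((h | h) | h), hv⟩
    · exact Or.inl (Or.inl ⟨h.1, h.2, hv⟩)
    · exact Or.inl (Or.inr ⟨h.1, h.2, hv⟩)
    · exact Or.inr ⟨h.1, h.2, hv⟩
  obtain ⟨n, hn⟩ := ENat.ne_top_iff_exists.1 (encard_ne_top_iff.2 hf)
  exact ultra_principal hG (med_ultra hG ha hb hc) n v hn.symm

lemma med_zero {a b c : Set (Set V)} {p : V} (h : med a b c = princ G p) :
    grom G p a b = 0 ∧ grom G p b c = 0 ∧ grom G p a c = 0 := by
  have key : ∀ t ∈ med a b c, p ∈ t := by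
    intro t ht; rw [h] at ht; exact ht.2
  refine ⟨grom_zero fun t h1 h2 => key t ?_, grom_zero fun t h1 h2 => key t ?_,
    grom_zero fun t h1 h2 => key t ?_⟩ <;>
  · simp only [med, mem_union, mem_inter_iff]; tauto

lemma op_zero (hG : IsCCC G) {a b c : Set (Set V)} (ha : IsUltra G a) (hb : IsUltra G b)
    {p : V} (h : med a b c = princ G p) (hop : Op G a b c) {w : Set (Set V)} (hw : IsUltra G w) :
    grom G p a w = 0 ∨ grom G p b w = 0 := by
  by_contra hn
  rw [not_or] at hn
  have ex : ∀ d : Set (Set V), grom G p d w ≠ 0 → ∃ t ∈ d, t ∈ w ∧ p ∉ t := by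
    intro d hd
    by_contra hc
    push Not at hc
    exact hd (grom_zero hc)
  obtain ⟨s, s1, s2, s3⟩ := ex a hn.1
  obtain ⟨t, t1, t2, t3⟩ := ex b hn.2
  have hz := grom_zero' (med_zero h).1
  have hmem : med a b w ∈ rInterval G a b := by
    refine ⟨med_ultra hG ha hb hw, ?_⟩
    intro t ht
    exact Or.inl (Or.inl ht)
  have hs := med_ultra hG ha hb hw
  have sm : s ∈ med a b w := Or.inr ⟨s2, s1⟩
  have tm : t ∈ med a b w := Or.inl (Or.inr ⟨t1, t2⟩)
  have hsh := ha.1 s s1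
  have hth := hb.1 t t1
  rw [hop.2, h] at hmem
  rcases hmem with hm | hm
  · have : tᶜ ∈ med a b w := hm.2 ⟨ultra_compl hG ha hth fun hta => t3 (hz t hta t1),
      half_compl hG hth, t3⟩
    exact (hs.2.1 t hth).1 tm this
  · have : sᶜ ∈ med a b w := hm.2 ⟨⟨half_compl hG hsh, s3⟩,
      ultra_compl hG hb hsh fun hta => s3 (hz s s1 hta)⟩
    exact (hs.2.1 s hsh).1 sm this

end basic

section rays
variable {V : Type*} {G : SimpleGraph V}

/-- The `n`-th halfspace of a ray. -/
def rH (G : SimpleGraph V) (r : ℕ → V) (n : ℕ) : Set V := edgeHalf G (r n) (r (n + 1))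

/-- Descending rays. -/
def Desc (G : SimpleGraph V) (r : ℕ → V) : Prop :=
  (∀ n, G.Adj (r n) (r (n + 1))) ∧ ∀ n, rH G r (n + 1) ⊆ rH G r n

lemma Desc.anti {r : ℕ → V} (hr : Desc G r) {m n : ℕ} (h : m ≤ n) : rH G r n ⊆ rH G r m :=
  antitone_nat_of_succ_le (f := rH G r) hr.2 h

lemma Desc.half {r : ℕ → V} (hr : Desc G r) (n : ℕ) : IsHalfspace G (rH G r n) :=
  half_of_edge (hr.1 n)

lemma Desc.mem_iff {r : ℕ → V} (hr : Desc G r) (n k : ℕ) : r k ∈ rH G r n ↔ n < k := by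
  constructor
  · intro h
    by_contra hn
    exact notMem_edgeHalf (hr.anti (not_lt.1 hn) h)
  · intro h
    obtain ⟨j, rfl⟩ : ∃ j, k = j + 1 := ⟨k - 1, by omega⟩
    exact hr.anti (Nat.lt_succ_iff.1 h) (mem_edgeHalf (hr.1 j))

lemma Desc.shift {r : ℕ → V} (hr : Desc G r) (N : ℕ) : Desc G (fun n => r (N + n)) :=
  ⟨fun n => hr.1 (N + n), fun n => hr.2 (N + n)⟩

lemma rayEnd_shift (r : ℕ → V) (N : ℕ) : rayEnd G (fun n => r (N + n)) = rayEnd G r := by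
  ext h
  constructor
  · rintro ⟨h1, M, h2⟩
    refine ⟨h1, N + M, fun n hn => ?_⟩
    have : r (N + (n - N)) ∈ h := h2 (n - N) (by omega)
    rwa [Nat.add_sub_cancel' (by omega)] at this
  · rintro ⟨h1, M, h2⟩
    exact ⟨h1, M, fun n hn => h2 (N + n) (by omega)⟩

/-- crossing -/
lemma Desc.cross (hG : IsCCC G) {r : ℕ → V} (hr : Desc G r) {h : Set V} (hh : IsHalfspace G h)
    {i j : ℕ} (hi : r i ∉ h) (hj : r j ∈ h) (hij : i ≤ j) : ∃ n, i ≤ n ∧ n < j ∧ h = rH G r n := by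
  induction j, hij using Nat.le_induction with
  | base => exact absurd hj hi
  | succ j hij ih =>
    by_cases hj' : r j ∈ h
    · obtain ⟨n, h1, h2, h3⟩ := ih hj'
      exact ⟨n, h1, by omega, h3⟩
    · exact ⟨j, hij, by omega, half_eq hG hh (hr.1 j) hj' hj⟩

lemma Desc.rH_mem {r : ℕ → V} (hr : Desc G r) (n : ℕ) : rH G r n ∈ rayEnd G r :=
  ⟨hr.half n, n + 1, fun k hk => (hr.mem_iff n k).2 (by omega)⟩

lemma Desc.mem_rayEnd (hG : IsCCC G) {r : ℕ → V} (hr : Desc G r) {h : Set V}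
    (hh : h ∈ rayEnd G r) {k : ℕ} (hk : r k ∉ h) : ∃ n, k ≤ n ∧ h = rH G r n := by
  obtain ⟨h1, N, h2⟩ := hh
  obtain ⟨n, h3, -, h4⟩ := hr.cross hG h1 hk (h2 (max N k) (le_max_left _ _)) (le_max_right _ _)
  exact ⟨n, h3, h4⟩

lemma Desc.ultra (hG : IsCCC G) {r : ℕ → V} (hr : Desc G r) : IsUltra G (rayEnd G r) := by
  refine ⟨fun h hh => hh.1, ?_, ?_⟩
  · intro h hh
    constructor
    · rintro ⟨-, N, h1⟩ ⟨-, M, h2⟩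
      exact h2 (max N M) (le_max_right _ _) (h1 (max N M) (le_max_left _ _))
    · intro hn
      by_contra hc
      by_cases h0 : ∃ i, r i ∉ h
      · obtain ⟨i, hi⟩ := h0
        by_cases h1 : ∃ j, i ≤ j ∧ r j ∈ h
        · obtain ⟨j, hij, hj⟩ := h1
          obtain ⟨n, -, -, rfl⟩ := hr.cross hG hh hi hj hij
          exact hc (hr.rH_mem n)
        · push Not at h1
          exact hn ⟨half_compl hG hh, i, fun n hn => h1 n hn⟩
      · push Not at h0
        exact hc ⟨hh, 0, fun n _ => h0 n⟩
  · rintro h ⟨-, N, h1⟩ k ⟨-, M, h2⟩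
    exact ⟨r (max N M), h1 _ (le_max_left _ _), h2 _ (le_max_right _ _)⟩

lemma Desc.inj {r : ℕ → V} (hr : Desc G r) : Function.Injective (rH G r) := by
  intro m n h
  have h1 := (hr.mem_iff m (m + 1)).2 (by omega)
  have h2 := (hr.mem_iff n (n + 1)).2 (by omega)
  rw [h] at h1
  rw [← h] at h2
  have := (hr.mem_iff _ _).1 h1
  have := (hr.mem_iff _ _).1 h2
  omega

/-- a vertex eventually leaves the halfspaces of a descending ray -/
lemma Desc.leave (hG : IsCCC G) {r : ℕ → V} (hr : Desc G r) (v : V) : ∃ n, v ∉ rH G r n := by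
  by_contra hc
  push Not at hc
  have : (Set.range (rH G r)).Finite := by
    refine (sep_finite hG (r 0) v).subset ?_
    rintro _ ⟨n, rfl⟩
    exact ⟨hr.half n, hc n, fun h => by simpa using (hr.mem_iff n 0).1 h⟩
  exact (infinite_range_of_injective hr.inj) this

lemma Desc.bdry (hG : IsCCC G) {r : ℕ → V} (hr : Desc G r) : IsBdryPt G (rayEnd G r) := by
  refine ⟨hr.ultra hG, fun v hv => ?_⟩
  obtain ⟨n, hn⟩ := hr.leave hG v
  have := hr.rH_mem n
  rw [hv] at this
  exact hn this.2

lemma straight_desc (_hG : IsCCC G) {x : Set (Set V)} (hx : IsStraightPt G x) :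
    ∃ r, Desc G r ∧ rayEnd G r = x := by
  obtain ⟨r, ⟨h1, h2⟩, h3, h4⟩ := hx
  refine ⟨r, ⟨h1, fun n => ?_⟩, h4⟩
  have key : ∀ k n : ℕ, r k ∈ edgeHalf G (r n) (r (n + 1)) ↔ n < k := by
    intro k n
    simp only [edgeHalf, mem_ofPred_eq]
    rcases lt_or_ge n k with h | h
    · rw [dsymm (r k), dsymm (r k), h2 _ _ h, h2 _ _ h.le]; omega
    · rw [h2 _ _ h, h2 _ _ (by omega : k ≤ n + 1)]; omega
  have := h3 n (n + 1)
  intro q hq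
  by_contra hn
  refine this ⟨⟨r (n + 2), ?_, ?_⟩, ⟨r (n + 1), ?_, ?_⟩, ⟨q, hn, hq⟩, ⟨r n, ?_, ?_⟩⟩
  · exact (key _ _).2 (by omega)
  · exact (key _ _).2 (by omega)
  · exact (key _ _).2 (by omega)
  · exact fun h => by have := (key _ _).1 h; omega
  · exact fun h => by have := (key _ _).1 h; omega
  · exact fun h => by have := (key _ _).1 h; omega

/-- existence of descending rays -/
lemma exists_ray (hG : IsCCC G) (hne : NoExtremal G) {v u : V} (h : G.Adj v u) :
    ∃ r, Desc G r ∧ r 0 = v ∧ r 1 = u := by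
  have step : ∀ e : {e : V × V // G.Adj e.1 e.2}, ∃ e' : {e : V × V // G.Adj e.1 e.2},
      e'.1.1 = e.1.2 ∧ edgeHalf G e'.1.1 e'.1.2 ⊆ edgeHalf G e.1.1 e.1.2 := by
    rintro ⟨⟨a, b⟩, hab⟩
    obtain ⟨c, hc, hd⟩ := exists_disj hG hne hab.symm
    refine ⟨⟨(b, c), hc⟩, rfl, ?_⟩
    rw [← edgeHalf_compl hG hab] at hd
    intro q hq
    by_contra hn
    have : q ∈ edgeHalf G b c ∩ (edgeHalf G a b)ᶜ := ⟨hq, hn⟩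
    rw [hd] at this
    exact this
  choose F hF using step
  let E : ℕ → {e : V × V // G.Adj e.1 e.2} := fun n => F^[n] ⟨(v, u), h⟩
  have hE : ∀ n, E (n + 1) = F (E n) := fun n => Function.iterate_succ_apply' _ _ _
  have h2 : ∀ n, (E (n + 1)).1.1 = (E n).1.2 := fun n => by rw [hE]; exact (hF _).1
  refine ⟨fun n => (E n).1.1, ⟨fun n => ?_, fun n => ?_⟩, rfl, ?_⟩
  · simp only [h2]; exact (E n).2
  · simp only [rH]
    rw [h2 (n + 1), h2 n]
    have := (hF (E n)).2
    rw [← hE, h2 n] at this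
    exact this
  · simp only [h2 0]; rfl

/-- Lemma Z -/
lemma Desc.zero (hG : IsCCC G) {r : ℕ → V} (hr : Desc G r) {τ : Set (Set V)} (ht : IsUltra G τ)
    {k : Set V} (hk : k ∈ τ) (hd : rH G r 0 ∩ k = ∅) : grom G (r 0) (rayEnd G r) τ = 0 := by
  apply grom_zero
  intro t h1 h2
  by_contra h3
  obtain ⟨n, -, rfl⟩ := hr.mem_rayEnd hG h1 h3
  exact ultra_disj ht h2 hk (subset_eq_empty (inter_subset_inter_left _ (hr.anti (Nat.zero_le n))) hd)

lemma Desc.zero' (hG : IsCCC G) {r : ℕ → V} (hr : Desc G r) {τ : Set (Set V)} (ht : IsUltra G τ)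
    (hk : rH G r 0 ∉ τ) : grom G (r 0) (rayEnd G r) τ = 0 :=
  hr.zero hG ht (ultra_compl hG ht (hr.half 0) hk) (inter_compl_self _)

lemma Desc.zero_distinct (hG : IsCCC G) {r s : ℕ → V} (hr : Desc G r) (hs : Desc G s)
    (h0 : r 0 = s 0) (hne : rH G r 0 ≠ rH G s 0) :
    grom G (r 0) (rayEnd G r) (rayEnd G s) = 0 := by
  have key : ∀ {r s : ℕ → V}, Desc G r → Desc G s → r 0 = s 0 → ∀ i j, rH G r i = rH G s j →
      rH G s 0 ⊆ rH G r 0 := by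
    intro r s hr hs h0 i j h
    have h1 : r (i + 1) ∈ rH G s 0 := by
      apply hs.anti (Nat.zero_le j)
      rw [← h]
      exact (hr.mem_iff _ _).2 (by omega)
    have h2 : r 0 ∉ rH G s 0 := by rw [h0]; exact notMem_edgeHalf
    obtain ⟨n, -, -, h3⟩ := hr.cross hG (hs.half 0) h2 h1 (by omega)
    rw [h3]
    exact hr.anti (Nat.zero_le _)
  apply grom_zero
  intro t h1 h2
  by_contra h3
  obtain ⟨n, -, e1⟩ := hr.mem_rayEnd hG h1 h3
  obtain ⟨m, -, e2⟩ := hs.mem_rayEnd hG h2 (h0 ▸ h3)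
  exact hne (Subset.antisymm (key hs hr h0.symm m n (by rw [← e1, ← e2]))
    (key hr hs h0 n m (by rw [← e1, ← e2])))

/-- infinite Gromov product with the end of a descending ray -/
lemma Desc.top (hG : IsCCC G) {r : ℕ → V} (hr : Desc G r) {τ : Set (Set V)} (ht : IsUltra G τ)
    (h : grom G (r 0) (rayEnd G r) τ = ⊤) (n : ℕ) : rH G r n ∈ τ := by
  by_contra hn
  have : {h | h ∈ rayEnd G r ∧ h ∈ τ ∧ r 0 ∉ h} ⊆ rH G r '' (Set.Iio n) := by
    rintro t ⟨h1, h2, h3⟩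
    obtain ⟨m, -, rfl⟩ := hr.mem_rayEnd hG h1 h3
    refine ⟨m, ?_, rfl⟩
    by_contra hc
    exact hn (ultra_up hG ht h2 (hr.half n) (hr.anti (not_lt.1 hc)))
  have hf := ((Set.finite_Iio n).image (rH G r)).subset this
  exact (encard_ne_top_iff.2 hf) h

/-- at most one infinite -/
lemma straight_one (hG : IsCCC G) {z a b : Set (Set V)} (hz : IsStraightPt G z)
    (ha : IsUltra G a) (hb : IsUltra G b) (v : V) (hab : grom G v a b ≠ ⊤) :
    grom G v z a ≠ ⊤ ∨ grom G v z b ≠ ⊤ := by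
  by_contra hn
  push Not at hn
  obtain ⟨r, hr, rfl⟩ := straight_desc hG hz
  have hu := hr.ultra hG
  have t1 : grom G (r 0) (rayEnd G r) a = ⊤ := by
    by_contra h; exact grom_base hG hu _ v h hn.1
  have t2 : grom G (r 0) (rayEnd G r) b = ⊤ := by
    by_contra h; exact grom_base hG hu _ v h hn.2
  have hf := grom_base hG ha _ (r 0) hab
  unfold grom at hf
  rw [encard_ne_top_iff] at hf
  have : (Set.range (rH G r)).Finite := by
    refine hf.subset ?_
    rintro _ ⟨n, rfl⟩
    exact ⟨hr.top hG ha t1 n, hr.top hG hb t2 n, fun h => by simpa using (hr.mem_iff n 0).1 h⟩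
  exact (infinite_range_of_injective hr.inj) this

/-- Lemma B, geometric part -/
lemma exists_pq (hG : IsCCC G) (hne : NoExtremal G) {a b : Set (Set V)} (ha : IsStraightPt G a)
    (hb : IsUltra G b) (hab : b ≠ a) (v : V) (htop : grom G v a b = ⊤) :
    ∃ p q, IsBdryPt G p ∧ IsBdryPt G q ∧ grom G v p q ≠ ⊤ ∧ grom G v p a ≠ ⊤ ∧
      grom G v p b ≠ ⊤ ∧ grom G v q a ≠ ⊤ ∧ grom G v q b ≠ ⊤ := by
  obtain ⟨r0, hr0, rfl⟩ := straight_desc hG ha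
  have hu := hr0.ultra hG
  have t1 : grom G (r0 0) (rayEnd G r0) b = ⊤ := by
    by_contra h; exact grom_base hG hu _ v h htop
  have hHb := hr0.top hG hb t1
  obtain ⟨g, hgb, hga⟩ : ∃ g ∈ b, g ∉ rayEnd G r0 := by
    by_contra hc
    push Not at hc
    apply hab
    refine Subset.antisymm hc fun h hh => ?_
    by_contra hn
    exact (hu.2.1 h (hu.1 h hh)).1 hh (hc _ (ultra_compl hG hb (hu.1 h hh) hn))
  have hgh := hb.1 g hgb
  obtain ⟨-, N, hN⟩ := ultra_compl hG hu hgh hga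
  obtain ⟨x, hx⟩ := half_nonempty hgh
  obtain ⟨M, hM⟩ := hr0.leave hG x
  -- shift
  obtain ⟨r, hr, hend, hrg, hrb, hrx⟩ : ∃ r, Desc G r ∧ rayEnd G r = rayEnd G r0 ∧
      (∀ n, r n ∉ g) ∧ (∀ n, rH G r n ∈ b) ∧ (∀ n, x ∉ rH G r n) := by
    refine ⟨fun n => r0 (max N M + n), hr0.shift _, rayEnd_shift _ _, fun n => ?_, fun n => ?_,
      fun n h => ?_⟩
    · exact hN _ (by have := le_max_left N M; omega)
    · exact hHb (max N M + n)
    · exact hM (hr0.anti (by have := le_max_right N M; omega) h)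
  rw [← hend]
  have hu' := hr.ultra hG
  have hHg : ∀ n, (rH G r n ∩ g).Nonempty := fun n => hb.2.2 _ (hrb n) _ hgb
  have nota : ∀ l, l ∩ g = ∅ → ∀ n, l ≠ rH G r n := by
    rintro l hl n rfl
    exact (hHg n).ne_empty hl
  obtain ⟨c0, hc0, hl0⟩ := exists_disj' hG hne hgh (hrg 0)
  obtain ⟨p, hp, hp0, hp1⟩ := exists_ray hG hne hc0
  have hpl : rH G p 0 = edgeHalf G (r 0) c0 := by rw [rH, hp0, hp1]
  have fin : ∀ {s : ℕ → V} {τ : Set (Set V)}, Desc G s → grom G (s 0) (rayEnd G s) τ = 0 →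
      grom G v (rayEnd G s) τ ≠ ⊤ := by
    intro s τ hs h
    exact grom_base hG (hs.ultra hG) (s 0) v (by rw [h]; simp)
  by_cases hcase : edgeHalf G (r 0) c0 ∩ rH G r 0 = ∅
  · obtain ⟨c1, hc1, hl1⟩ := exists_disj' hG hne hgh (hrg 1)
    obtain ⟨q, hq, hq0, hq1⟩ := exists_ray hG hne hc1
    have hql : rH G q 0 = edgeHalf G (r 1) c1 := by rw [rH, hq0, hq1]
    have hH0q : rH G r 0 ∈ rayEnd G q := by
      by_contra hn
      have h1 := ultra_compl hG (hq.ultra hG) (hr.half 0) hn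
      have h2 : q 0 ∉ (rH G r 0)ᶜ := by
        rw [hq0]; exact fun h => h ((hr.mem_iff 0 1).2 (by omega))
      obtain ⟨n, -, h3⟩ := hq.mem_rayEnd hG h1 h2
      have h4 : x ∈ rH G q 0 := by
        apply hq.anti (Nat.zero_le n)
        rw [← h3]; exact hrx 0
      rw [hql] at h4
      have : x ∈ edgeHalf G (r 1) c1 ∩ g := ⟨h4, hx⟩
      rw [hl1] at this
      exact this
    refine ⟨rayEnd G p, rayEnd G q, hp.bdry hG, hq.bdry hG, fin hp ?_, fin hp ?_, fin hp ?_,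
      fin hq ?_, fin hq ?_⟩
    · exact hp.zero hG (hq.ultra hG) hH0q (by rw [hpl]; exact hcase)
    · exact hp.zero hG hu' (hr.rH_mem 0) (by rw [hpl]; exact hcase)
    · exact hp.zero hG hb hgb (by rw [hpl]; exact hl0)
    · apply hq.zero' hG hu'
      rw [hql]
      intro h
      obtain ⟨n, -, h3⟩ := hr.mem_rayEnd hG h (k := 1) notMem_edgeHalf
      exact nota _ hl1 n h3
    · exact hq.zero hG hb hgb (by rw [hql]; exact hl1)
  · obtain ⟨c1, hc1, hl1⟩ := exists_disj' hG hne (hr.half 0) (v := r 0) notMem_edgeHalf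
    obtain ⟨q, hq, hq0, hq1⟩ := exists_ray hG hne hc1
    have hql : rH G q 0 = edgeHalf G (r 0) c1 := by rw [rH, hq0, hq1]
    refine ⟨rayEnd G p, rayEnd G q, hp.bdry hG, hq.bdry hG, fin hp ?_, fin hp ?_, fin hp ?_,
      fin hq ?_, fin hq ?_⟩
    · apply hp.zero_distinct hG hq (hp0.trans hq0.symm)
      rw [hpl, hql]
      intro h
      rw [h] at hcase
      exact hcase hl1
    · apply hp.zero' hG hu'
      rw [hpl]
      intro h
      obtain ⟨n, -, h3⟩ := hr.mem_rayEnd hG h (k := 0) notMem_edgeHalf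
      exact nota _ hl0 n h3
    · exact hp.zero hG hb hgb (by rw [hpl]; exact hl0)
    · exact hq.zero hG hu' (hr.rH_mem 0) (by rw [hql]; exact hl1)
    · exact hq.zero hG hb (hrb 0) (by rw [hql]; exact hl1)

/-- distance formula, inequality -/
lemma dist_ineq (hG : IsCCC G) {u a b : Set (Set V)} (hu : IsUltra G u) (hb : IsUltra G b)
    (ha : IsUltra G a) (m n : V) :
    grom G m u b + grom G n u a ≤ grom G n u b + grom G m u a + (G.dist m n : ℕ∞) ∧
    (grom G m a (princ G n) = 0 → grom G n b (princ G m) = 0 →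
      grom G m u b + grom G n u a = grom G n u b + grom G m u a + (G.dist m n : ℕ∞)) := by
  -- common parts
  have split : ∀ (c : Set (Set V)) (m n : V), grom G m u c =
      {h | h ∈ u ∧ h ∈ c ∧ m ∉ h ∧ n ∉ h}.encard + {h | h ∈ u ∧ h ∈ c ∧ m ∉ h ∧ n ∈ h}.encard := by
    intro c m n
    rw [← encard_union_eq]
    · unfold grom; congr 1; ext h; simp only [mem_ofPred_eq, mem_union]; tauto
    · rw [disjoint_left]; rintro h ⟨-, -, -, h1⟩ ⟨-, -, -, h2⟩; exact h1 h2
  have cm : ∀ (c : Set (Set V)), {h | h ∈ u ∧ h ∈ c ∧ m ∉ h ∧ n ∉ h} =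
      {h | h ∈ u ∧ h ∈ c ∧ n ∉ h ∧ m ∉ h} := by
    intro c; ext h; simp only [mem_ofPred_eq]; tauto
  have hd : (G.dist m n : ℕ∞) = {h | h ∈ u ∧ IsHalfspace G h ∧ n ∈ h ∧ m ∉ h}.encard +
      {h | h ∈ u ∧ IsHalfspace G h ∧ m ∈ h ∧ n ∉ h}.encard := by
    rw [← sep_count hG _ m n rfl]
    have e : {h | h ∈ u ∧ IsHalfspace G h ∧ m ∈ h ∧ n ∉ h}.encard =
        {h | h ∉ u ∧ IsHalfspace G h ∧ n ∈ h ∧ m ∉ h}.encard := by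
      rw [← (compl_injective (α := Set V)).encard_image]
      congr 1
      ext h
      simp only [mem_image, mem_ofPred_eq]
      constructor
      · rintro ⟨k, ⟨h1, h2, h3, h4⟩, rfl⟩
        exact ⟨(hu.2.1 k h2).1 h1, half_compl hG h2, h4, fun h => h h3⟩
      · rintro ⟨h1, h2, h3, h4⟩
        exact ⟨hᶜ, ⟨ultra_compl hG hu h2 h1, half_compl hG h2, h4, fun h => h h3⟩, compl_compl h⟩
    rw [e, ← encard_union_eq]
    · congr 1; ext h; simp only [mem_ofPred_eq, mem_union]; tauto
    · rw [disjoint_left]; rintro h ⟨h1, -⟩ ⟨h2, -⟩; exact h2 h1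
  rw [split b m n, split a n m, split b n m, split a m n, cm b, cm a, hd]
  constructor
  · have i1 : {h | h ∈ u ∧ h ∈ b ∧ m ∉ h ∧ n ∈ h}.encard ≤
        {h | h ∈ u ∧ IsHalfspace G h ∧ n ∈ h ∧ m ∉ h}.encard := by
      apply encard_le_encard
      rintro h ⟨h1, h2, h3, h4⟩
      exact ⟨h1, hu.1 h h1, h4, h3⟩
    have i2 : {h | h ∈ u ∧ h ∈ a ∧ n ∉ h ∧ m ∈ h}.encard ≤
        {h | h ∈ u ∧ IsHalfspace G h ∧ m ∈ h ∧ n ∉ h}.encard := by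
      apply encard_le_encard
      rintro h ⟨h1, h2, h3, h4⟩
      exact ⟨h1, hu.1 h h1, h4, h3⟩
    calc _ ≤ ({h | h ∈ u ∧ h ∈ b ∧ n ∉ h ∧ m ∉ h}.encard + {h | h ∈ u ∧ IsHalfspace G h ∧ n ∈ h ∧ m ∉ h}.encard) +
          ({h | h ∈ u ∧ h ∈ a ∧ n ∉ h ∧ m ∉ h}.encard + {h | h ∈ u ∧ IsHalfspace G h ∧ m ∈ h ∧ n ∉ h}.encard) := by
            gcongr
      _ = ({h | h ∈ u ∧ h ∈ b ∧ n ∉ h ∧ m ∉ h}.encard + 0) +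
          ({h | h ∈ u ∧ h ∈ a ∧ n ∉ h ∧ m ∉ h}.encard + 0) +
          ({h | h ∈ u ∧ IsHalfspace G h ∧ n ∈ h ∧ m ∉ h}.encard +
            {h | h ∈ u ∧ IsHalfspace G h ∧ m ∈ h ∧ n ∉ h}.encard) := by ring
      _ ≤ _ := by gcongr <;> exact zero_le
  · intro hm hn
    have hm' := grom_zero' hm
    have hn' := grom_zero' hn
    have z1 : {h | h ∈ u ∧ h ∈ b ∧ n ∉ h ∧ m ∈ h} = ∅ := by
      ext h
      simp only [mem_ofPred_eq, mem_empty_iff_false, iff_false]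
      rintro ⟨h1, h2, h3, h4⟩
      exact h3 (hn' h h2 ⟨hu.1 h h1, h4⟩)
    have z2 : {h | h ∈ u ∧ h ∈ a ∧ m ∉ h ∧ n ∈ h} = ∅ := by
      ext h
      simp only [mem_ofPred_eq, mem_empty_iff_false, iff_false]
      rintro ⟨h1, h2, h3, h4⟩
      exact h3 (hm' h h2 ⟨hu.1 h h1, h4⟩)
    have e1 : {h | h ∈ u ∧ h ∈ b ∧ m ∉ h ∧ n ∈ h} =
        {h | h ∈ u ∧ IsHalfspace G h ∧ n ∈ h ∧ m ∉ h} := by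
      ext h
      constructor
      · rintro ⟨h1, h2, h3, h4⟩
        exact ⟨h1, hu.1 h h1, h4, h3⟩
      · rintro ⟨h1, h2, h3, h4⟩
        refine ⟨h1, ?_, h4, h3⟩
        by_contra hc
        exact hn' _ (ultra_compl hG hb h2 hc) ⟨half_compl hG h2, h4⟩ h3
    have e2 : {h | h ∈ u ∧ h ∈ a ∧ n ∉ h ∧ m ∈ h} =
        {h | h ∈ u ∧ IsHalfspace G h ∧ m ∈ h ∧ n ∉ h} := by
      ext h
      constructor
      · rintro ⟨h1, h2, h3, h4⟩
        exact ⟨h1, hu.1 h h1, h4, h3⟩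
      · rintro ⟨h1, h2, h3, h4⟩
        refine ⟨h1, ?_, h4, h3⟩
        by_contra hc
        exact hm' _ (ultra_compl hG ha h2 hc) ⟨half_compl hG h2, h4⟩ h3
    rw [z1, z2, e1, e2, encard_empty]
    ring

end rays
section mobius

variable {V V' : Type*} {G : SimpleGraph V} {G' : SimpleGraph V'}

/-- finite Gromov product -/
def Fn (G : SimpleGraph V) (a b : Bdry G) : Prop := ∀ v, grom G v a.1 b.1 ≠ ⊤

/-- the Gromov product as a natural number -/
noncomputable def P (G : SimpleGraph V) (v : V) (a b : Bdry G) : ℕ := (grom G v a.1 b.1).toNat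

lemma fn_of (hG : IsCCC G) {a b : Bdry G} {v : V} (h : grom G v a.1 b.1 ≠ ⊤) : Fn G a b :=
  fun w => grom_base hG a.2.1 v w h

lemma fn_of_zero (hG : IsCCC G) {a b : Bdry G} {v : V} (h : grom G v a.1 b.1 = 0) : Fn G a b :=
  fn_of hG (v := v) (by rw [h]; simp)

lemma Fn.comm {a b : Bdry G} (h : Fn G a b) : Fn G b a := fun v => by
  rw [grom_comm]; exact h v

lemma P_comm (v : V) (a b : Bdry G) : P G v a b = P G v b a := by
  unfold P; rw [grom_comm]

lemma Fn.eq {a b : Bdry G} (h : Fn G a b) (v : V) : grom G v a.1 b.1 = (P G v a b : ℕ∞) :=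
  (ENat.natCast_toNat (h v)).symm

lemma P_of_zero {a b : Bdry G} {v : V} (h : grom G v a.1 b.1 = 0) : P G v a b = 0 := by
  unfold P; rw [h]; rfl

lemma Fn.zero {a b : Bdry G} (h : Fn G a b) {v : V} (h0 : P G v a b = 0) :
    grom G v a.1 b.1 = 0 := by
  rw [h.eq, h0]; rfl

lemma toE_nat (n : ℕ) : toE (n : ℕ∞) = ((n : ℝ) : EReal) := by
  unfold toE
  rw [ENat.toENNReal_coe]
  rfl

lemma toE_top : toE ⊤ = ⊤ := by
  unfold toE; simp

lemma crv_fin (v : V) {a b c d : Bdry G} (h1 : Fn G a c) (h2 : Fn G b d) (h3 : Fn G a d)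
    (h4 : Fn G b c) : crv G v a.1 b.1 c.1 d.1 =
      (((P G v a c : ℝ) + P G v b d - P G v a d - P G v b c : ℝ) : EReal) := by
  unfold crv
  rw [h1.eq, h2.eq, h3.eq, h4.eq, toE_nat, toE_nat, toE_nat, toE_nat]
  norm_cast

lemma M1 (hG : IsCCC G) (hG' : IsCCC G') {f : Bdry G → Bdry G'} (hmob : Mobius G G' f)
    {a b : Bdry G} (h : Fn G a b) : Fn G' (f a) (f b) := by
  intro v'
  have h1 := (hmob a a b b fun v => Or.inr (Or.inr
    ⟨by simp [tripod, h v], by simp [tripod, h v]⟩)).1 v'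
  unfold inA at h1
  simp only [tripod, grom_self_top hG' v' (f a).2, grom_self_top hG' v' (f b).2] at h1
  simp at h1
  exact h1

lemma M2 {f : Bdry G → Bdry G'} (hG : IsCCC G) (hG' : IsCCC G') (hmob : Mobius G G' f)
    (v : V) (v' : V') {a b c d : Bdry G} (h1 : Fn G a c) (h2 : Fn G b d) (h3 : Fn G a d)
    (h4 : Fn G b c) :
    P G' v' (f a) (f c) + P G' v' (f b) (f d) + (P G v a d + P G v b c) =
    P G v a c + P G v b d + (P G' v' (f a) (f d) + P G' v' (f b) (f c)) := by
  have h := (hmob a b c d fun v => Or.inr (Or.inr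
    ⟨by simp [tripod, h1 v, h2 v], by simp [tripod, h3 v, h4 v]⟩)).2 v v'
  rw [crv_fin v h1 h2 h3 h4, crv_fin v' (M1 hG hG' hmob h1) (M1 hG hG' hmob h2)
    (M1 hG hG' hmob h3) (M1 hG hG' hmob h4)] at h
  have h' := EReal.coe_eq_coe_iff.1 h
  have : (P G' v' (f a) (f c) + P G' v' (f b) (f d) + (P G v a d + P G v b c) : ℝ) =
    P G v a c + P G v b d + (P G' v' (f a) (f d) + P G' v' (f b) (f c)) := by linarith
  exact_mod_cast this

lemma M3 {f : Bdry G → Bdry G'} (hG : IsCCC G) (hG' : IsCCC G') (hmob : Mobius G G' f)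
    (v : V) (v' : V') {a b c d : Bdry G} (h1 : grom G v a.1 c.1 = ⊤) (h2 : Fn G b d)
    (h3 : Fn G a d) (h4 : Fn G b c) (h5 : Fn G a b) (h6 : Fn G c d) :
    grom G' v' (f a).1 (f c).1 = ⊤ := by
  by_contra hc
  have hc' : Fn G' (f a) (f c) := fn_of hG' hc
  have h := (hmob a b c d fun v => Or.inr (Or.inl
    ⟨by simp [tripod, h5 v, h6 v], by simp [tripod, h3 v, h4 v]⟩)).2 v v'
  rw [crv_fin v' hc' (M1 hG hG' hmob h2) (M1 hG hG' hmob h3) (M1 hG hG' hmob h4)] at h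
  unfold crv at h
  rw [h1, h2.eq, h3.eq, h4.eq, toE_nat, toE_nat, toE_nat, toE_top, EReal.top_add_coe,
    EReal.top_sub_coe, EReal.top_sub_coe] at h
  exact EReal.coe_ne_top _ h

/-- Straight points: infinite Gromov products are preserved. -/
lemma inf_pres {f : Bdry G → Bdry G'} (hG : IsCCC G) (hG' : IsCCC G') (hne : NoExtremal G)
    (hmob : Mobius G G' f) {a b : Bdry G} (ha : IsStraightPt G a.1)
    (h : Fn G' (f a) (f b)) : Fn G a b := by
  obtain ⟨v'⟩ := hG'.1.nonempty
  intro v htop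
  by_cases hab : b = a
  · subst hab
    exact h v' (grom_self_top hG' v' (f b).2)
  · obtain ⟨p, q, hp, hq, h1, h2, h3, h4, h5⟩ := exists_pq hG hne ha b.2.1
      (fun e => hab (Subtype.ext e)) v htop
    have e1 : Fn G ⟨p, hp⟩ ⟨q, hq⟩ := fn_of hG (v := v) h1
    have e2 : Fn G ⟨p, hp⟩ a := fn_of hG (v := v) h2
    have e3 : Fn G ⟨p, hp⟩ b := fn_of hG (v := v) h3
    have e4 : Fn G ⟨q, hq⟩ a := fn_of hG (v := v) h4
    have e5 : Fn G ⟨q, hq⟩ b := fn_of hG (v := v) h5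
    exact h v' (M3 hG hG' hmob v v' htop e1 e4.comm e3 e2.comm e5.comm)

lemma princ_ultra (hG : IsCCC G) (v : V) : IsUltra G (princ G v) := by
  refine ⟨fun h hh => hh.1, fun h hh => ⟨fun h1 h2 => h2.2 h1.2, fun h1 => ?_⟩,
    fun h hh k hk => ⟨v, hh.2, hk.2⟩⟩
  by_contra h2
  exact h1 ⟨half_compl hG hh, fun h3 => h2 ⟨hh, h3⟩⟩

/-- configuration of three straight points and medians in both complexes -/
structure Cfg (G : SimpleGraph V) (G' : SimpleGraph V') (f : Bdry G → Bdry G')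
    (x1 x2 x : Bdry G) (m : V) (m' : V') : Prop where
  s1 : IsStraightPt G x1.1
  s2 : IsStraightPt G x2.1
  s3 : IsStraightPt G x.1
  z12 : grom G m x1.1 x2.1 = 0
  z23 : grom G m x2.1 x.1 = 0
  z13 : grom G m x1.1 x.1 = 0
  op : ∀ w, IsUltra G w → grom G m x1.1 w = 0 ∨ grom G m x2.1 w = 0
  w12 : grom G' m' (f x1).1 (f x2).1 = 0
  w23 : grom G' m' (f x2).1 (f x).1 = 0
  w13 : grom G' m' (f x1).1 (f x).1 = 0

lemma Cfg.symm {f : Bdry G → Bdry G'} {x1 x2 x : Bdry G} {m : V} {m' : V'}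
    (c : Cfg G G' f x1 x2 x m m') : Cfg G G' f x2 x1 x m m' :=
  ⟨c.s2, c.s1, c.s3, by rw [grom_comm]; exact c.z12, c.z13, c.z23,
    fun w hw => (c.op w hw).symm, by rw [grom_comm]; exact c.w12, c.w13, c.w23⟩

variable {f : Bdry G → Bdry G'} {x1 x2 x : Bdry G} {m : V} {m' : V'}

lemma claim (hG : IsCCC G) (hG' : IsCCC G') (hne : NoExtremal G) (hne' : NoExtremal G')
    (hsurj : Function.Surjective f) (hmob : Mobius G G' f)
    (c : Cfg G G' f x1 x2 x m m') {z : Bdry G} (hz : IsStraightPt G z.1)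
    (hf : Fn G z x2) (h0 : grom G' m' (f z).1 (f x1).1 ≠ 0) :
    P G' m' (f z) (f x2) ≤ P G m z x2 := by
  obtain ⟨h, hh1, hh2, hh3⟩ : ∃ h, h ∈ (f z).1 ∧ h ∈ (f x1).1 ∧ m' ∉ h := by
    by_contra hcon
    push Not at hcon
    exact h0 (grom_zero hcon)
  obtain ⟨b, hb, hd⟩ := exists_disj' hG' hne' ((f z).2.1.1 h hh1) hh3
  obtain ⟨r, hr, hr0, hr1⟩ := exists_ray hG' hne' hb
  have hrH : rH G' r 0 = edgeHalf G' m' b := by rw [rH, hr0, hr1]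
  obtain ⟨w, hw⟩ := hsurj ⟨rayEnd G' r, hr.bdry hG'⟩
  have hw' : (f w).1 = rayEnd G' r := by rw [hw]
  have k1 : grom G' m' (f w).1 (f x1).1 = 0 := by
    rw [hw', ← hr0]
    exact hr.zero hG' (f x1).2.1 hh2 (by rw [hrH]; exact hd)
  have kz : grom G' m' (f w).1 (f z).1 = 0 := by
    rw [hw', ← hr0]
    exact hr.zero hG' (f z).2.1 hh1 (by rw [hrH]; exact hd)
  have k2 : grom G' m' (f w).1 (f x2).1 = 0 ∨ grom G' m' (f w).1 (f x).1 = 0 := by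
    by_cases hl : rH G' r 0 ∈ (f x2).1
    · right
      rw [hw', ← hr0]
      apply hr.zero' hG' (f x).2.1
      intro hl2
      have := grom_zero' c.w23 _ hl hl2
      rw [hrH] at this
      exact notMem_edgeHalf this
    · left
      rw [hw', ← hr0]
      exact hr.zero' hG' (f x2).2.1 hl
  have back : ∀ {a : Bdry G}, IsStraightPt G a.1 → grom G' m' (f w).1 (f a).1 = 0 → Fn G w a :=
    fun ha h => (inf_pres hG hG' hne hmob ha (fn_of_zero hG' h).comm).comm
  have f1 := back c.s1 k1
  have fz := back hz kz
  have f12 := fn_of_zero hG c.z12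
  have f13 := fn_of_zero hG c.z13
  have f23 := fn_of_zero hG c.z23
  have q1 := P_of_zero k1
  have qz := P_of_zero kz
  have p12 := P_of_zero c.z12
  have p13 := P_of_zero c.z13
  have p23 := P_of_zero c.z23
  have q12 := P_of_zero c.w12
  have q13 := P_of_zero c.w13
  have q23 := P_of_zero c.w23
  have key : P G m w x1 = 0 := by
    rcases k2 with k2 | k3
    · have f2 := back c.s2 k2
      have q2 := P_of_zero k2
      have := M2 hG hG' hmob m m' f1 f23.comm f2 f13.comm
      rw [P_comm m x x2, P_comm m x x1, P_comm m' (f x) (f x2), P_comm m' (f x) (f x1)] at this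
      have op : P G m w x1 = 0 ∨ P G m w x2 = 0 := by
        rw [P_comm m w x1, P_comm m w x2]
        exact (c.op w.1 w.2.1).imp P_of_zero P_of_zero
      omega
    · rcases c.op w.1 w.2.1 with o | o
      · rw [P_comm]; exact P_of_zero o
      · have f2 := (fn_of_zero hG o).comm
        have p2 := P_of_zero o
        rw [P_comm] at p2
        have := M2 hG hG' hmob m m' f1 f23.comm f2 f13.comm
        rw [P_comm m x x2, P_comm m x x1, P_comm m' (f x) (f x2), P_comm m' (f x) (f x1)] at this
        omega
  have := M2 hG hG' hmob m m' fz f12.comm f1 hf.comm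
  rw [P_comm m x2 x1, P_comm m x2 z, P_comm m' (f x2) (f x1), P_comm m' (f x2) (f z)] at this
  omega

lemma propC1 (hG : IsCCC G) (hG' : IsCCC G') (hne : NoExtremal G) (hne' : NoExtremal G')
    (hsurj : Function.Surjective f) (hmob : Mobius G G' f)
    (c : Cfg G G' f x1 x2 x m m') {z : Bdry G} (hz : IsStraightPt G z.1)
    (hf : Fn G z x1) : P G' m' (f z) (f x1) = P G m z x1 := by
  have p13 := P_of_zero c.z13
  have p23 := P_of_zero c.z23
  have q13 := P_of_zero c.w13
  have q23 := P_of_zero c.w23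
  have f13 := fn_of_zero hG c.z13
  have f23 := fn_of_zero hG c.z23
  by_cases h2 : Fn G z x2
  · have := M2 hG hG' hmob m m' hf f23.comm h2 f13.comm
    rw [P_comm m x x2, P_comm m x x1, P_comm m' (f x) (f x2), P_comm m' (f x) (f x1)] at this
    have op : P G m z x1 = 0 ∨ P G m z x2 = 0 := by
      rw [P_comm m z x1, P_comm m z x2]
      exact (c.op z.1 z.2.1).imp P_of_zero P_of_zero
    have c1 : P G' m' (f z) (f x1) ≠ 0 → P G' m' (f z) (f x2) ≤ P G m z x2 := fun h =>
      claim hG hG' hne hne' hsurj hmob c hz h2 (fun h' => h (P_of_zero h'))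
    have c2 : P G' m' (f z) (f x2) ≠ 0 → P G' m' (f z) (f x1) ≤ P G m z x1 := fun h =>
      claim hG hG' hne hne' hsurj hmob c.symm hz hf (fun h' => h (P_of_zero h'))
    by_cases e1 : P G' m' (f z) (f x1) = 0 <;> by_cases e2 : P G' m' (f z) (f x2) = 0 <;>
      simp only [e1, e2, ne_eq, not_true_eq_false, not_false_eq_true, false_imp_iff,
        true_imp_iff] at c1 c2 <;> omega
  · have hle := claim hG hG' hne hne' hsurj hmob c.symm hz hf fun h' =>
      h2 (inf_pres hG hG' hne hmob hz (fn_of_zero hG' h'))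
    have : P G m z x1 = 0 := by
      rcases c.op z.1 z.2.1 with o | o
      · rw [P_comm]; exact P_of_zero o
      · exact absurd (fn_of_zero hG o).comm h2
    omega

lemma propC3 (hG : IsCCC G) (hG' : IsCCC G') (hne : NoExtremal G) (hne' : NoExtremal G')
    (hsurj : Function.Surjective f) (hmob : Mobius G G' f)
    (c : Cfg G G' f x1 x2 x m m') {z : Bdry G} (hz : IsStraightPt G z.1)
    (hf : Fn G z x) : P G' m' (f z) (f x) = P G m z x := by
  wlog h1 : Fn G z x1 generalizing x1 x2
  · have h2 : Fn G z x2 := by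
      rcases straight_one hG hz x1.2.1 x2.2.1 m (by rw [c.z12]; simp) with h | h
      · exact absurd (fn_of hG h) h1
      · exact fn_of hG h
    exact this c.symm h2
  have p12 := P_of_zero c.z12
  have p23 := P_of_zero c.z23
  have q12 := P_of_zero c.w12
  have q23 := P_of_zero c.w23
  have e := propC1 hG hG' hne hne' hsurj hmob c hz h1
  have := M2 hG hG' hmob m m' h1 (fn_of_zero hG c.z23) hf (fn_of_zero hG c.z12).comm
  rw [P_comm m x2 x1, P_comm m' (f x2) (f x1)] at this
  omega

/-- two finite options -/
lemma Cfg.two (hG : IsCCC G) (c : Cfg G G' f x1 x2 x m m') {z : Bdry G}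
    (hz : IsStraightPt G z.1) :
    (Fn G z x1 ∧ Fn G z x2) ∨ (Fn G z x1 ∧ Fn G z x) ∨ (Fn G z x2 ∧ Fn G z x) := by
  have a := (straight_one hG hz x1.2.1 x2.2.1 m (by rw [c.z12]; simp)).imp (fn_of hG) (fn_of hG)
  have b := (straight_one hG hz x2.2.1 x.2.1 m (by rw [c.z23]; simp)).imp (fn_of hG) (fn_of hG)
  have d := (straight_one hG hz x1.2.1 x.2.1 m (by rw [c.z13]; simp)).imp (fn_of hG) (fn_of hG)
  tauto

lemma propD (hG : IsCCC G) (hG' : IsCCC G') (hne : NoExtremal G) (hne' : NoExtremal G')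
    (hsurj : Function.Surjective f) (hmob : Mobius G G' f)
    (c : Cfg G G' f x1 x2 x m m') {z w : Bdry G} (hz : IsStraightPt G z.1)
    (hw : IsStraightPt G w.1) (hf : Fn G z w) : P G' m' (f z) (f w) = P G m z w := by
  have aux : ∀ a b : Bdry G, grom G m a.1 b.1 = 0 → grom G' m' (f a).1 (f b).1 = 0 →
      Fn G z b → Fn G w a → P G' m' (f z) (f b) = P G m z b →
      P G' m' (f w) (f a) = P G m w a → P G' m' (f z) (f w) = P G m z w := by
    intro a b h1 h2 h3 h4 h5 h6
    have := M2 hG hG' hmob m m' hf (fn_of_zero hG h1) h3 h4.comm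
    rw [P_comm m a w, P_comm m' (f a) (f w), P_of_zero h1, P_of_zero h2] at this
    omega
  have z1 := propC1 hG hG' hne hne' hsurj hmob c hz
  have z2 := propC1 hG hG' hne hne' hsurj hmob c.symm hz
  have z3 := propC3 hG hG' hne hne' hsurj hmob c hz
  have w1 := propC1 hG hG' hne hne' hsurj hmob c hw
  have w2 := propC1 hG hG' hne hne' hsurj hmob c.symm hw
  have w3 := propC3 hG hG' hne hne' hsurj hmob c hw
  have z21 := c.z12
  have z32 := c.z23
  have z31 := c.z13
  have w21 := c.w12
  have w32 := c.w23
  have w31 := c.w13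
  rw [grom_comm] at z21 z32 z31 w21 w32 w31
  rcases c.two hG hz with ⟨h1, h2⟩ | ⟨h1, h3⟩ | ⟨h2, h3⟩ <;>
  rcases c.two hG hw with ⟨k1, k2⟩ | ⟨k1, k3⟩ | ⟨k2, k3⟩
  · exact aux _ _ c.z12 c.w12 h2 k1 (z2 h2) (w1 k1)
  · exact aux _ _ c.z12 c.w12 h2 k1 (z2 h2) (w1 k1)
  · exact aux _ _ z21 w21 h1 k2 (z1 h1) (w2 k2)
  · exact aux _ _ z21 w21 h1 k2 (z1 h1) (w2 k2)
  · exact aux _ _ c.z13 c.w13 h3 k1 (z3 h3) (w1 k1)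
  · exact aux _ _ z31 w31 h1 k3 (z1 h1) (w3 k3)
  · exact aux _ _ c.z12 c.w12 h2 k1 (z2 h2) (w1 k1)
  · exact aux _ _ c.z12 c.w12 h2 k1 (z2 h2) (w1 k1)
  · exact aux _ _ z32 w32 h2 k3 (z2 h2) (w3 k3)

lemma propE (hG : IsCCC G) (hG' : IsCCC G') (hne : NoExtremal G) (hne' : NoExtremal G')
    (hsurj : Function.Surjective f) (hmob : Mobius G G' f)
    (c : Cfg G G' f x1 x2 x m m') {y1 y2 y : Bdry G} {n' : V'}
    (t1 : IsStraightPt G y1.1) (t2 : IsStraightPt G y2.1) (t3 : IsStraightPt G y.1)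
    (hmed : med (f y1).1 (f y2).1 (f y).1 = princ G' n') :
    grom G' m' (f x1).1 (princ G' n') = 0 ∨ grom G' m' (f x2).1 (princ G' n') = 0 := by
  by_contra hcon
  push Not at hcon
  obtain ⟨g1, g2⟩ := hcon
  have ex : ∀ {a : Set (Set V')}, grom G' m' a (princ G' n') ≠ 0 →
      ∃ h ∈ a, h ∈ med (f y1).1 (f y2).1 (f y).1 ∧ m' ∉ h := by
    intro a ha
    by_contra hcon
    push Not at hcon
    exact ha (grom_zero fun t h1 h2 => hcon t h1 (by rw [hmed]; exact h2))
  obtain ⟨h, h1, h2, h3⟩ := ex g1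
  obtain ⟨k, k1, k2, k3⟩ := ex g2
  have main : ∀ {u : Bdry G}, IsStraightPt G u.1 → h ∈ (f u).1 → k ∈ (f u).1 → False := by
    intro u hu hhu hku
    rcases c.op u.1 u.2.1 with o | o
    · have hfn := (fn_of_zero hG o).comm
      have e := propC1 hG hG' hne hne' hsurj hmob c hu hfn
      rw [P_comm m, P_of_zero o] at e
      exact h3 (grom_zero' ((M1 hG hG' hmob hfn).zero e) h hhu h1)
    · have hfn := (fn_of_zero hG o).comm
      have e := propC1 hG hG' hne hne' hsurj hmob c.symm hu hfn
      rw [P_comm m, P_of_zero o] at e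
      exact k3 (grom_zero' ((M1 hG hG' hmob hfn).zero e) k hku k1)
  have m1 := main t1
  have m2 := main t2
  have m3 := main t3
  rcases h2 with (⟨a, b⟩ | ⟨a, b⟩) | ⟨a, b⟩ <;> rcases k2 with (⟨a', b'⟩ | ⟨a', b'⟩) | ⟨a', b'⟩ <;>
    tauto

/-- comparison of distances -/
lemma dist_cmp (hG : IsCCC G) (hG' : IsCCC G') (hne : NoExtremal G) (hne' : NoExtremal G')
    (hsurj : Function.Surjective f) (hmob : Mobius G G' f)
    (c : Cfg G G' f x1 x2 x m m') {y1 y2 y : Bdry G} {n : V} {n' : V'}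
    (c' : Cfg G G' f y1 y2 y n n') {a b : Bdry G} (ha : a = x1 ∨ a = x2)
    (hb : b = y1 ∨ b = y2) :
    (grom G m a.1 (princ G n) = 0 → grom G n b.1 (princ G m) = 0 →
      G.dist m n ≤ G'.dist m' n') ∧
    (grom G' m' (f a).1 (princ G' n') = 0 → grom G' n' (f b).1 (princ G' m') = 0 →
      G'.dist m' n' ≤ G.dist m n) := by
  have hbs : IsStraightPt G b.1 := by
    rcases hb with rfl | rfl
    exacts [c'.s1, c'.s2]
  have has : IsStraightPt G a.1 := by
    rcases ha with rfl | rfl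
    exacts [c.s1, c.s2]
  obtain ⟨u, hus, hua, hub⟩ : ∃ u : Bdry G, IsStraightPt G u.1 ∧ Fn G u a ∧ Fn G u b := by
    have e12 := fn_of_zero hG c.z12
    have e13 := fn_of_zero hG c.z13
    have e23 := fn_of_zero hG c.z23
    have t := c.two hG hbs
    rcases ha with rfl | rfl
    · by_cases h : Fn G b x
      · exact ⟨x, c.s3, e13.comm, h.comm⟩
      · exact ⟨x2, c.s2, e12.comm, (show Fn G b x2 by tauto).comm⟩
    · by_cases h : Fn G b x
      · exact ⟨x, c.s3, e23.comm, h.comm⟩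
      · exact ⟨x1, c.s1, e12, (show Fn G b x1 by tauto).comm⟩
  have d1 := propD hG hG' hne hne' hsurj hmob c hus has hua
  have d2 := propD hG hG' hne hne' hsurj hmob c hus hbs hub
  have d3 := propD hG hG' hne hne' hsurj hmob c' hus has hua
  have d4 := propD hG hG' hne hne' hsurj hmob c' hus hbs hub
  have i := dist_ineq hG u.2.1 b.2.1 a.2.1 m n
  have i' := dist_ineq hG' (f u).2.1 (f b).2.1 (f a).2.1 m' n'
  have fa' := M1 hG hG' hmob hua
  have fb' := M1 hG hG' hmob hub
  rw [hua.eq, hua.eq, hub.eq, hub.eq] at i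
  rw [fa'.eq, fa'.eq, fb'.eq, fb'.eq] at i'
  obtain ⟨i1, i2⟩ := i
  obtain ⟨i1', i2'⟩ := i'
  norm_cast at i1 i2 i1' i2'
  constructor
  · intro h1 h2
    have := i2 h1 h2
    omega
  · intro h1 h2
    have := i2' h1 h2
    omega

lemma med_fin (hG : IsCCC G) (hG' : IsCCC G') (hmob : Mobius G G' f)
    (hop : Op G x1.1 x2.1 x.1) : ∃ p' : V', med (f x1).1 (f x2).1 (f x).1 = princ G' p' := by
  obtain ⟨⟨p, hp⟩, -⟩ := hop
  obtain ⟨h1, h2, h3⟩ := med_zero hp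
  obtain ⟨v'⟩ := hG'.1.nonempty
  exact med_princ hG' (f x1).2.1 (f x2).2.1 (f x).2.1 v' (M1 hG hG' hmob (fn_of_zero hG h1) v')
    (M1 hG hG' hmob (fn_of_zero hG h2) v') (M1 hG hG' hmob (fn_of_zero hG h3).comm v')

lemma mkCfg (hG : IsCCC G) (s1 : IsStraightPt G x1.1) (s2 : IsStraightPt G x2.1)
    (s3 : IsStraightPt G x.1) (hop : Op G x1.1 x2.1 x.1)
    (h : med x1.1 x2.1 x.1 = princ G m) (h' : med (f x1).1 (f x2).1 (f x).1 = princ G' m') :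
    Cfg G G' f x1 x2 x m m' := by
  obtain ⟨h1, h2, h3⟩ := med_zero h
  obtain ⟨h1', h2', h3'⟩ := med_zero h'
  exact ⟨s1, s2, s3, h1, h2, h3, fun w hw => op_zero hG x1.2.1 x2.2.1 h hop hw, h1', h2', h3'⟩

end mobius

end CCCR

open CCCR
/-- Corollary `isom for straight`: for straight boundary points
with `x1 op_x x2` and `y1 op_y y2`, a Möbius bijection preserves the distance
between the corresponding medians. -/
theorem stmt15 {V V' : Type*} (G : SimpleGraph V) (G' : SimpleGraph V')
    (hG : IsCCC G) (hG' : IsCCC G') (hne : NoExtremal G) (hne' : NoExtremal G')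
    (f : Bdry G → Bdry G') (hbij : Function.Bijective f) (hmob : Mobius G G' f)
    (x1 x2 x y1 y2 y : Bdry G)
    (hs1 : IsStraightPt G x1.1) (hs2 : IsStraightPt G x2.1) (hs3 : IsStraightPt G x.1)
    (hs4 : IsStraightPt G y1.1) (hs5 : IsStraightPt G y2.1) (hs6 : IsStraightPt G y.1)
    (hopx : Op G x1.1 x2.1 x.1) (hopy : Op G y1.1 y2.1 y.1) :
    (∃ p' : V', med (f x1).1 (f x2).1 (f x).1 = princ G' p') ∧
    (∃ q' : V', med (f y1).1 (f y2).1 (f y).1 = princ G' q') ∧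
    ∀ (p q : V) (p' q' : V'),
      med x1.1 x2.1 x.1 = princ G p → med y1.1 y2.1 y.1 = princ G q →
      med (f x1).1 (f x2).1 (f x).1 = princ G' p' →
      med (f y1).1 (f y2).1 (f y).1 = princ G' q' →
      G.dist p q = G'.dist p' q' := by
  refine ⟨med_fin hG hG' hmob hopx, med_fin hG hG' hmob hopy, ?_⟩
  intro p q p' q' hp hq hp' hq'
  have c := mkCfg (f := f) hG hs1 hs2 hs3 hopx hp hp'
  have c' := mkCfg (f := f) hG hs4 hs5 hs6 hopy hq hq'
  have hs := hbij.surjective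
  have cmp := fun a b ha hb =>
    dist_cmp (a := a) (b := b) hG hG' hne hne' hs hmob c c' ha hb
  apply le_antisymm
  · rcases c.op _ (princ_ultra hG q) with h | h <;>
    rcases c'.op _ (princ_ultra hG p) with k | k
    · exact (cmp _ _ (Or.inl rfl) (Or.inl rfl)).1 h k
    · exact (cmp _ _ (Or.inl rfl) (Or.inr rfl)).1 h k
    · exact (cmp _ _ (Or.inr rfl) (Or.inl rfl)).1 h k
    · exact (cmp _ _ (Or.inr rfl) (Or.inr rfl)).1 h k
  · rcases propE hG hG' hne hne' hs hmob c hs4 hs5 hs6 hq' with h | h <;>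
    rcases propE hG hG' hne hne' hs hmob c' hs1 hs2 hs3 hp' with k | k
    · exact (cmp _ _ (Or.inl rfl) (Or.inl rfl)).2 h k
    · exact (cmp _ _ (Or.inl rfl) (Or.inr rfl)).2 h k
    · exact (cmp _ _ (Or.inr rfl) (Or.inl rfl)).2 h k
    · exact (cmp _ _ (Or.inr rfl) (Or.inr rfl)).2 h k
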